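/- Let F ⊂ ℝⁿ be a compact convex set with positive volume, let P be a non-constant polynomial on ℝⁿ of degree at most d, and let E ⊆ F be a measurable set with Vol(E) > 0. Then the averages of log|P| satisfy |(1/Vol(E)) ∫_E log|P(x)| dx − (1/Vol(F)) ∫_F log|P(x)| dx| ≤ d · log(4e² · Vol(F)/Vol(E)). -/

import Mathlib

open MeasureTheory

/-- One-dimensional Brunn–Minkowski inequality, for the weighted sum of two sets. -/
theorem Real.volume_weighted_sum_le {A B C : Set ℝ} (hA : MeasurableSet A) (hB : MeasurableSet B)
    (hA0 : A.Nonempty) (hB0 : B.Nonempty) {s : ℝ} (hs0 : 0 < s) (hs1 : s < 1)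
    (h : ∀ x ∈ A, ∀ y ∈ B, (1 - s) * x + s * y ∈ C) :
    ENNReal.ofReal (1 - s) * volume A + ENNReal.ofReal s * volume B ≤ volume C := by
  have key : ∀ K ⊆ A, IsCompact K → ∀ L ⊆ B, IsCompact L →
      ENNReal.ofReal (1 - s) * volume K + ENNReal.ofReal s * volume L ≤ volume C := by
    have key' : ∀ K ⊆ A, IsCompact K → K.Nonempty → ∀ L ⊆ B, IsCompact L → L.Nonempty →
        ENNReal.ofReal (1 - s) * volume K + ENNReal.ofReal s * volume L ≤ volume C := by
      intro K hKA hK hK0 L hLB hL hL0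
      obtain ⟨a, haK, ha⟩ := hK.exists_isGreatest hK0
      obtain ⟨b, hbL, hb⟩ := hL.exists_isLeast hL0
      set K' : Set ℝ := (fun x => (1 - s) * x + s * b) '' K with hK'
      set L' : Set ℝ := (fun y => (1 - s) * a + s * y) '' L with hL'
      have hvK : volume K' = ENNReal.ofReal (1 - s) * volume K := by
        have : K' = (fun x => s * b + x) '' ((fun x => (1 - s) • x) '' K) := by
          rw [Set.image_image]; simp only [hK', smul_eq_mul, add_comm]
        rw [this, Set.image_add_left, measure_preimage_add]
        have := Measure.addHaar_smul (volume : Measure ℝ) (1 - s) K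
        rw [← Set.image_smul] at this
        rw [this]; simp [abs_of_pos (sub_pos.2 hs1)]
      have hvL : volume L' = ENNReal.ofReal s * volume L := by
        have : L' = (fun x => (1 - s) * a + x) '' ((fun x => s • x) '' L) := by
          rw [Set.image_image]; simp only [hL', smul_eq_mul]
        rw [this, Set.image_add_left, measure_preimage_add]
        have := Measure.addHaar_smul (volume : Measure ℝ) s L
        rw [← Set.image_smul] at this
        rw [this]; simp [abs_of_pos hs0]
      have hmL : MeasurableSet L' := (hL.image (by fun_prop)).measurableSet
      have hint : volume (K' ∩ L') = 0 := by
        refine measure_mono_null (t := {(1 - s) * a + s * b}) ?_ (by simp)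
        rintro z ⟨⟨x, hx, rfl⟩, ⟨y, hy, hxy⟩⟩
        simp only at hxy
        have h1 := ha hx
        have h2 := hb hy
        simp only [Set.mem_singleton_iff]
        nlinarith
      rw [← hvK, ← hvL, ← measure_union_add_inter K' hmL, hint, add_zero]
      apply measure_mono
      rintro z (⟨x, hx, rfl⟩ | ⟨y, hy, rfl⟩)
      · exact h _ (hKA hx) _ (hLB hbL)
      · exact h _ (hKA haK) _ (hLB hy)
    intro K hKA hK L hLB hL
    obtain ⟨a, ha⟩ := hA0
    obtain ⟨b, hb⟩ := hB0
    refine le_trans ?_ (key' (insert a K) (Set.insert_subset ha hKA) (hK.insert a) ⟨a, by simp⟩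
      (insert b L) (Set.insert_subset hb hLB) (hL.insert b) ⟨b, by simp⟩)
    gcongr <;> simp
  rw [hA.measure_eq_iSup_isCompact, hB.measure_eq_iSup_isCompact]
  simp only [ENNReal.mul_iSup, iSup_and']
  refine ENNReal.biSup_add_biSup_le' ⟨∅, by simp⟩ ⟨∅, by simp⟩ ?_
  rintro K ⟨hKA, hK⟩ L ⟨hLB, hL⟩
  exact key K hKA hK L hLB hL

theorem ENNReal.geom_mean_le_arith_mean2 {s : ℝ} (hs0 : 0 < s) (hs1 : s < 1) (x y : ENNReal) :
    x ^ (1 - s) * y ^ s ≤ ENNReal.ofReal (1 - s) * x + ENNReal.ofReal s * y := by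
  rcases eq_or_ne x ⊤ with rfl | hx
  · simp [ENNReal.mul_top, hs1]
  rcases eq_or_ne y ⊤ with rfl | hy
  · simp [ENNReal.mul_top, hs0]
  lift x to NNReal using hx
  lift y to NNReal using hy
  have := NNReal.geom_mean_le_arith_mean2_weighted (1 - s).toNNReal s.toNNReal x y
    (by rw [← Real.toNNReal_add (by linarith) hs0.le]; simp)
  simp only [Real.coe_toNNReal _ (sub_pos.2 hs1).le, Real.coe_toNNReal _ hs0.le] at this
  rw [← ENNReal.coe_rpow_of_nonneg _ (sub_pos.2 hs1).le, ← ENNReal.coe_rpow_of_nonneg _ hs0.le]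
  rw [ENNReal.ofReal, ENNReal.ofReal]
  exact_mod_cast this

/-- Layer-cake formula on the unit interval, for a function bounded by `c`. -/
theorem lintegral_eq_mul_lintegral_meas_lt {f : ℝ → ENNReal} (hf : Measurable f) {c : ENNReal}
    (hc0 : c ≠ 0) (hc : c ≠ ⊤) (hfc : ∀ x, f x ≤ c) :
    ∫⁻ x, f x = c * ∫⁻ t in Set.Ioo (0 : ℝ) 1, volume {x | c * ENNReal.ofReal t < f x} := by
  have hr : ∀ x, f x = c * ENNReal.ofReal (f x / c).toReal := fun x => by
    rw [ENNReal.ofReal_toReal (ENNReal.div_ne_top ((hfc x).trans_lt hc.lt_top).ne hc0),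
      ENNReal.mul_div_cancel hc0 hc]
  have hset : ∀ t : ℝ, 0 < t → {x | c * ENNReal.ofReal t < f x} = {x | t < (f x / c).toReal} := by
    intro t ht
    ext x
    simp only [Set.mem_ofPred_eq]
    rw [hr x, ENNReal.mul_lt_mul_iff_right hc0 hc, ENNReal.ofReal_lt_ofReal_iff_of_nonneg ht.le]
    rw [← hr x]
  have h1 := lintegral_eq_lintegral_meas_lt (volume : Measure ℝ)
    (f := fun x => (f x / c).toReal) (Filter.Eventually.of_forall fun x => ENNReal.toReal_nonneg)
    (by fun_prop)
  rw [lintegral_congr hr, lintegral_const_mul _ (by fun_prop), h1]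
  congr 1
  rw [← Set.Ioo_union_Ici_eq_Ioi zero_lt_one, lintegral_union measurableSet_Ici
    (Set.disjoint_left.2 fun x hx hx' => absurd hx.2 (not_lt.2 hx'))]
  rw [setLIntegral_congr_fun (g := fun _ => 0) measurableSet_Ici, lintegral_zero, add_zero]
  · exact setLIntegral_congr_fun measurableSet_Ioo fun t ht => by
      simp only [hset t ht.1]
  · intro t ht
    have : {x | t < (f x / c).toReal} = ∅ := by
      ext x
      simp only [Set.mem_ofPred_eq, Set.mem_empty_iff_false, iff_false, not_lt]
      refine le_trans ?_ ht
      exact ENNReal.toReal_le_of_le_ofReal zero_le_one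
        (by simpa using ENNReal.div_le_of_le_mul (by simpa using hfc x))
    simp only [this, measure_empty]

theorem mul_lintegral_meas_lt_le {f : ℝ → ENNReal} (hf : Measurable f) {c : ENNReal}
    (hc0 : c ≠ 0) (hc : c ≠ ⊤) :
    c * ∫⁻ t in Set.Ioo (0 : ℝ) 1, volume {x | c * ENNReal.ofReal t < f x} ≤ ∫⁻ x, f x := by
  calc _ = ∫⁻ x, min (f x) c := by
        rw [lintegral_eq_mul_lintegral_meas_lt (hf.min measurable_const) hc0 hc
          fun x => min_le_right _ _]
        congr 1
        refine setLIntegral_congr_fun measurableSet_Ioo fun t ht => ?_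
        congr 1
        ext x
        have : c * ENNReal.ofReal t < c := by
          conv_rhs => rw [← mul_one c]
          rw [ENNReal.mul_lt_mul_iff_right hc0 hc]
          simpa using ht.2
        simp [this]
    _ ≤ _ := lintegral_mono fun x => min_le_left _ _

/-- One-dimensional Prékopa–Leindler inequality, for bounded functions. -/
theorem prekopa_leindler_real_of_bounded {f g h : ℝ → ENNReal} (hf : Measurable f)
    (hg : Measurable g) (hh : Measurable h) {s : ℝ} (hs0 : 0 < s) (hs1 : s < 1)
    (hfb : ⨆ x, f x ≠ ⊤) (hgb : ⨆ x, g x ≠ ⊤)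
    (H : ∀ x y, f x ^ (1 - s) * g y ^ s ≤ h ((1 - s) * x + s * y)) :
    (∫⁻ x, f x) ^ (1 - s) * (∫⁻ x, g x) ^ s ≤ ∫⁻ x, h x := by
  have hs1' : 0 < 1 - s := sub_pos.2 hs1
  set a := ⨆ x, f x with ha
  set b := ⨆ x, g x with hb
  have hfa : ∀ x, f x ≤ a := le_iSup f
  have hgb' : ∀ x, g x ≤ b := le_iSup g
  rcases eq_or_ne a 0 with ha0 | ha0
  · have : ∀ x, f x = 0 := fun x => le_antisymm (ha0 ▸ hfa x) bot_le
    simp [this, hs1']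
  rcases eq_or_ne b 0 with hb0 | hb0
  · have : ∀ x, g x = 0 := fun x => le_antisymm (hb0 ▸ hgb' x) bot_le
    simp [this, hs0]
  set c := a ^ (1 - s) * b ^ s with hc
  have hc0 : c ≠ 0 := by
    refine mul_ne_zero ?_ ?_ <;> simp only [ne_eq, ENNReal.rpow_eq_zero_iff, ha0, hb0, hfb, hgb,
      false_and, or_self, not_false_eq_true]
  have hct : c ≠ ⊤ := ENNReal.mul_ne_top (ENNReal.rpow_ne_top_of_nonneg hs1'.le hfb)
    (ENNReal.rpow_ne_top_of_nonneg hs0.le hgb)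
  rw [lintegral_eq_mul_lintegral_meas_lt hf ha0 hfb hfa,
    lintegral_eq_mul_lintegral_meas_lt hg hb0 hgb hgb',
    ENNReal.mul_rpow_of_nonneg _ _ hs1'.le, ENNReal.mul_rpow_of_nonneg _ _ hs0.le,
    mul_mul_mul_comm]
  refine le_trans ?_ (mul_lintegral_meas_lt_le hh hc0 hct)
  gcongr
  refine (ENNReal.geom_mean_le_arith_mean2 hs0 hs1 _ _).trans ?_
  have hm : ∀ {u : ℝ → ENNReal} (e : ENNReal), Measurable fun t : ℝ =>
      volume {x | e * ENNReal.ofReal t < u x} := fun e =>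
    Antitone.measurable fun t t' htt' => measure_mono fun x hx =>
      lt_of_le_of_lt (mul_le_mul_right (ENNReal.ofReal_le_ofReal htt') e) hx
  rw [← lintegral_const_mul _ (hm a), ← lintegral_const_mul _ (hm b),
    ← lintegral_add_left ((hm a).const_mul _)]
  refine setLIntegral_mono' measurableSet_Ioo fun t ht => ?_
  have hlt : ∀ e : ENNReal, e ≠ 0 → e ≠ ⊤ → e * ENNReal.ofReal t < e := fun e he he' => by
    conv_rhs => rw [← mul_one e]
    rw [ENNReal.mul_lt_mul_iff_right he he']
    simpa using ht.2
  refine Real.volume_weighted_sum_le (measurableSet_lt measurable_const hf)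
    (measurableSet_lt measurable_const hg) (lt_iSup_iff.1 (hlt a ha0 hfb))
    (lt_iSup_iff.1 (hlt b hb0 hgb)) hs0 hs1 fun x hx y hy => ?_
  simp only [Set.mem_ofPred_eq] at hx hy ⊢
  refine lt_of_lt_of_le ?_ (H x y)
  calc c * ENNReal.ofReal t
      = (a * ENNReal.ofReal t) ^ (1 - s) * (b * ENNReal.ofReal t) ^ s := by
        rw [ENNReal.mul_rpow_of_nonneg _ _ hs1'.le, ENNReal.mul_rpow_of_nonneg _ _ hs0.le,
          mul_mul_mul_comm, ← ENNReal.rpow_add_of_nonneg _ _ hs1'.le hs0.le]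
        simp [hc]
    _ < f x ^ (1 - s) * g y ^ s :=
        ENNReal.mul_lt_mul (ENNReal.rpow_lt_rpow hx hs1') (ENNReal.rpow_lt_rpow hy hs0)

/-- One-dimensional Prékopa–Leindler inequality. -/
theorem prekopa_leindler_real {f g h : ℝ → ENNReal} (hf : Measurable f)
    (hg : Measurable g) (hh : Measurable h) {s : ℝ} (hs0 : 0 < s) (hs1 : s < 1)
    (H : ∀ x y, f x ^ (1 - s) * g y ^ s ≤ h ((1 - s) * x + s * y)) :
    (∫⁻ x, f x) ^ (1 - s) * (∫⁻ x, g x) ^ s ≤ ∫⁻ x, h x := by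
  have hs1' : 0 < 1 - s := sub_pos.2 hs1
  have trunc : ∀ {u : ℝ → ENNReal}, Measurable u →
      ∫⁻ x, u x = ⨆ N : ℕ, ∫⁻ x, min (u x) N := by
    intro u hu
    rw [← lintegral_iSup (fun N => hu.min measurable_const)
      (fun N M hNM x => min_le_min_left _ (by exact_mod_cast hNM))]
    congr 1 with x
    rw [← inf_iSup_eq, ENNReal.iSup_natCast, inf_top_eq]
  have rpow_iSup : ∀ {r : ℝ}, 0 < r → ∀ u : ℕ → ENNReal, (⨆ N, u N) ^ r = ⨆ N, u N ^ r :=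
    fun hr u => (ENNReal.orderIsoRpow _ hr).map_iSup u
  rw [trunc hf, trunc hg, rpow_iSup hs1', rpow_iSup hs0]
  simp only [ENNReal.iSup_mul, ENNReal.mul_iSup, iSup_le_iff]
  intro N M
  have hb : ∀ (u : ℝ → ENNReal) (N : ℕ), ⨆ x, min (u x) (N : ENNReal) ≠ ⊤ := fun u N =>
    ((iSup_le fun x => min_le_right _ _).trans_lt (ENNReal.natCast_lt_top N)).ne
  refine prekopa_leindler_real_of_bounded (hf.min measurable_const) (hg.min measurable_const) hh
    hs0 hs1 (hb _ _) (hb _ _) fun x y => le_trans ?_ (H x y)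
  gcongr <;> exact min_le_left _ _

theorem measurable_insertNth {n : ℕ} (i : Fin (n + 1)) :
    Measurable fun p : ℝ × (Fin n → ℝ) => (i.insertNth p.1 p.2 : Fin (n + 1) → ℝ) :=
  (MeasurableEquiv.piFinSuccAbove (fun _ => ℝ) i).symm.measurable

/-- Tonelli's theorem, singling out the coordinate `i`. -/
theorem lintegral_eq_lintegral_insertNth {n : ℕ} (i : Fin (n + 1)) {u : (Fin (n + 1) → ℝ) → ENNReal}
    (hu : Measurable u) :
    ∫⁻ x, u x = ∫⁻ t : ℝ, ∫⁻ y : Fin n → ℝ, u (i.insertNth t y) := by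
  rw [← ((volume_preserving_piFinSuccAbove (fun _ => ℝ) i).symm).lintegral_comp hu]
  exact lintegral_prod _ (hu.comp (measurable_insertNth i)).aemeasurable

theorem insertNth_weighted_sum {n : ℕ} (i : Fin (n + 1)) (s a b : ℝ) (x y : Fin n → ℝ) :
    ((1 - s) • (i.insertNth a x : Fin (n + 1) → ℝ) + s • (i.insertNth b y : Fin (n + 1) → ℝ)) =
      i.insertNth ((1 - s) * a + s * b) ((1 - s) • x + s • y) := by
  ext j
  refine Fin.succAboveCases i ?_ (fun k => ?_) j <;> simp

/-- Prékopa–Leindler inequality on `ℝⁿ`. -/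
theorem prekopa_leindler {n : ℕ} {f g h : (Fin n → ℝ) → ENNReal} (hf : Measurable f)
    (hg : Measurable g) (hh : Measurable h) {s : ℝ} (hs0 : 0 < s) (hs1 : s < 1)
    (H : ∀ x y, f x ^ (1 - s) * g y ^ s ≤ h ((1 - s) • x + s • y)) :
    (∫⁻ x, f x) ^ (1 - s) * (∫⁻ x, g x) ^ s ≤ ∫⁻ x, h x := by
  induction n with
  | zero =>
    have h1 : volume (Set.univ : Set (Fin 0 → ℝ)) = 1 := by
      rw [volume_pi, Measure.pi_univ, Finset.univ_eq_empty, Finset.prod_empty]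
    simp only [lintegral_unique, h1, mul_one]
    exact (H _ _).trans (congrArg h (Subsingleton.elim _ _)).le
  | succ n ih =>
    have hm : ∀ {u : (Fin (n + 1) → ℝ) → ENNReal}, Measurable u →
        Measurable fun p : ℝ × (Fin n → ℝ) => u ((0 : Fin (n + 1)).insertNth p.1 p.2) :=
      fun hu => hu.comp (measurable_insertNth 0)
    rw [lintegral_eq_lintegral_insertNth 0 hf, lintegral_eq_lintegral_insertNth 0 hg,
      lintegral_eq_lintegral_insertNth 0 hh]
    refine prekopa_leindler_real (hm hf).lintegral_prod_right' (hm hg).lintegral_prod_right'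
      (hm hh).lintegral_prod_right' hs0 hs1 fun a b => ?_
    refine ih ((hm hf).comp measurable_prodMk_left) ((hm hg).comp measurable_prodMk_left)
      ((hm hh).comp measurable_prodMk_left) fun x y => ?_
    rw [← insertNth_weighted_sum]
    exact H _ _

/-- A set of reals of measure more than `k * h` contains `k + 1` points with gaps at least `h`. -/
theorem exists_separated_points {h : ℝ} (hh : 0 ≤ h) (k : ℕ) {S : Set ℝ} (hS : BddBelow S)
    (hk : ENNReal.ofReal (k * h) < volume S) :
    ∃ y : ℕ → ℝ, (∀ i ≤ k, y i ∈ S) ∧ ∀ i < k, y i + h ≤ y (i + 1) := by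
  induction k generalizing S with
  | zero =>
    obtain ⟨y, hy⟩ := nonempty_of_measure_ne_zero (bot_lt_iff_ne_bot.1 (bot_le.trans_lt hk))
    exact ⟨fun _ => y, by simp [hy], by simp⟩
  | succ k ih =>
    obtain ⟨r, hr0, hr1, hr2⟩ := ENNReal.lt_iff_exists_real_btwn.1 hk
    have hr3 : (k + 1 : ℝ) * h < r := by
      have := (ENNReal.ofReal_lt_ofReal_iff_of_nonneg (by positivity)).1 hr1
      exact_mod_cast this
    have hne : S.Nonempty := nonempty_of_measure_ne_zero (bot_lt_iff_ne_bot.1 (bot_le.trans_lt hk))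
    obtain ⟨y₀, hy₀, hy₀'⟩ := Real.lt_sInf_add_pos hne (sub_pos.2 hr3)
    have hcover : S ⊆ Set.Icc (sInf S) (y₀ + h) ∪ (S ∩ Set.Ici (y₀ + h)) := by
      intro z hz
      rcases le_total z (y₀ + h) with h1 | h1
      · exact Or.inl ⟨csInf_le hS hz, h1⟩
      · exact Or.inr ⟨hz, h1⟩
    have hS' : ENNReal.ofReal (k * h) < volume (S ∩ Set.Ici (y₀ + h)) := by
      by_contra! hcon
      have h1 : volume S ≤ ENNReal.ofReal (y₀ + h - sInf S) + ENNReal.ofReal (k * h) := by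
        refine (measure_mono hcover).trans ((measure_union_le _ _).trans ?_)
        rw [Real.volume_Icc]
        gcongr
      have h2 : sInf S ≤ y₀ := csInf_le hS hy₀
      rw [← ENNReal.ofReal_add (by linarith) (by positivity)] at h1
      refine absurd (hr2.trans_le h1) (not_lt.2 (ENNReal.ofReal_le_ofReal ?_))
      linarith
    obtain ⟨y, hy, hy'⟩ := ih (hS.mono Set.inter_subset_left) hS'
    refine ⟨fun i => Nat.casesOn i y₀ y, fun i hi => ?_, fun i hi => ?_⟩
    · cases i with
      | zero => exact hy₀
      | succ i => exact (hy i (by lia)).1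
    · cases i with
      | zero => exact (hy 0 (by lia)).2
      | succ i => exact hy' i (by lia)

theorem prod_abs_sub_erase_range (i m : ℕ) :
    ∏ j ∈ (Finset.range (i + m + 1)).erase i, |(i : ℝ) - j| = i.factorial * m.factorial := by
  induction m with
  | zero =>
    have : (Finset.range (i + 0 + 1)).erase i = Finset.range i := by
      ext j; simp; lia
    rw [this, ← Finset.prod_range_reflect, ← Finset.prod_range_add_one_eq_factorial]
    push_cast
    simp only [Nat.factorial_zero, Nat.cast_one, mul_one]
    refine Finset.prod_congr rfl fun j hj => ?_
    have : j + 1 ≤ i := Finset.mem_range.1 hj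
    rw [Nat.sub_sub, Nat.cast_sub (by lia)]
    push_cast
    rw [abs_of_nonneg] <;> linarith [(j.cast_nonneg : (0 : ℝ) ≤ j)]
  | succ m ih =>
    rw [← add_assoc, Finset.range_add_one, Finset.erase_insert_of_ne (by lia),
      Finset.prod_insert (by simp), ih, Nat.factorial_succ]
    push_cast
    rw [abs_sub_comm, abs_of_nonneg (by linarith [(m.cast_nonneg : (0 : ℝ) ≤ m)])]
    ring

theorem sum_inv_factorial_mul_factorial (d : ℕ) :
    ∑ i ∈ Finset.range (d + 1), ((i.factorial * (d - i).factorial : ℝ))⁻¹ =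
      2 ^ d / d.factorial := by
  rw [eq_div_iff (by positivity), Finset.sum_mul]
  have := Nat.sum_range_choose d
  rw [← Nat.cast_inj (R := ℝ)] at this
  push_cast at this
  rw [← this]
  refine Finset.sum_congr rfl fun i hi => ?_
  rw [Nat.cast_choose ℝ (by simpa [Nat.lt_succ_iff] using hi)]
  field_simp

/-- Growth of a polynomial away from separated nodes, by Lagrange interpolation. -/
theorem Polynomial.abs_eval_le_of_separated {p : Polynomial ℝ} {d : ℕ} (hp : p.natDegree ≤ d)
    {y : ℕ → ℝ} {h A R x : ℝ} (hh : 0 < h) (hy : ∀ i < d, y i + h ≤ y (i + 1))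
    (hA : ∀ i ≤ d, |p.eval (y i)| ≤ A) (hR : ∀ i ≤ d, |x - y i| ≤ R) :
    |p.eval x| ≤ A * ((R / h) ^ d * (2 ^ d / d.factorial)) := by
  have hgap' : ∀ k i, i + k ≤ d → h * k ≤ y (i + k) - y i := by
    intro k
    induction k with
    | zero => intro i _; simp
    | succ k ih =>
      intro i hi
      have h1 := ih i (by lia)
      have h2 := hy (i + k) (by lia)
      push_cast
      rw [← add_assoc]
      linarith
  have hgap : ∀ i ≤ d, ∀ j ≤ d, h * |(i : ℝ) - j| ≤ |y i - y j| := by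
    intro i hi j hj
    rcases le_total i j with hij | hij
    · obtain ⟨k, rfl⟩ := Nat.exists_eq_add_of_le hij
      have := hgap' k i hj
      rw [abs_sub_comm (y i)]
      refine le_trans ?_ (this.trans (le_abs_self _))
      simp
    · obtain ⟨k, rfl⟩ := Nat.exists_eq_add_of_le hij
      have := hgap' k j hi
      refine le_trans ?_ (this.trans (le_abs_self _))
      simp
  have hinj : Set.InjOn y (Finset.range (d + 1)) := by
    intro i hi j hj hij
    have := hgap i (by simpa [Nat.lt_succ_iff] using hi) j (by simpa [Nat.lt_succ_iff] using hj)
    rw [hij, sub_self, abs_zero] at this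
    have h0 : |(i : ℝ) - j| ≤ 0 := by
      by_contra! hc
      nlinarith
    have := abs_eq_zero.1 (le_antisymm h0 (abs_nonneg _))
    exact_mod_cast sub_eq_zero.1 this
  have hA0 : 0 ≤ A := (abs_nonneg _).trans (hA 0 (by lia))
  have hR0 : 0 ≤ R := (abs_nonneg _).trans (hR 0 (by lia))
  have hbasis : ∀ i ∈ Finset.range (d + 1), |(Lagrange.basis (Finset.range (d + 1)) y i).eval x| ≤
      (R / h) ^ d * ((i.factorial * (d - i).factorial : ℝ))⁻¹ := by
    intro i hi
    have hid : i ≤ d := by simpa [Nat.lt_succ_iff] using hi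
    obtain ⟨m, rfl⟩ := Nat.exists_eq_add_of_le hid
    rw [Nat.add_sub_cancel_left, ← prod_abs_sub_erase_range, Lagrange.basis, Polynomial.eval_prod,
      Finset.abs_prod, ← Finset.prod_inv_distrib]
    have hcard : ((Finset.range (i + m + 1)).erase i).card = i + m := by
      rw [Finset.card_erase_of_mem hi]; simp
    have hpow : (R / h) ^ (i + m) = ∏ _j ∈ (Finset.range (i + m + 1)).erase i, R / h := by
      rw [Finset.prod_const, hcard]
    rw [hpow, ← Finset.prod_mul_distrib]
    refine Finset.prod_le_prod (fun _ _ => abs_nonneg _) fun j hj => ?_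
    have hj' : j ≤ i + m := by
      simpa [Nat.lt_succ_iff] using Finset.mem_range.1 (Finset.mem_of_mem_erase hj)
    have hne : (i : ℝ) - j ≠ 0 := by
      rw [sub_ne_zero]; exact_mod_cast (Finset.ne_of_mem_erase hj).symm
    have hpos : 0 < |(i : ℝ) - j| := abs_pos.2 hne
    have h1 := hgap i hid j hj'
    have h2 : 0 < |y i - y j| := lt_of_lt_of_le (by positivity) h1
    simp only [Lagrange.basisDivisor, Polynomial.eval_mul, Polynomial.eval_C, Polynomial.eval_sub,
      Polynomial.eval_X, abs_mul, abs_inv]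
    rw [mul_comm, ← div_eq_mul_inv, ← div_eq_mul_inv, div_div]
    exact div_le_div₀ hR0 (hR j hj') (by positivity) h1
  have hdeg : p.degree < (Finset.range (d + 1)).card := by
    rw [Finset.card_range]
    exact (Polynomial.degree_le_of_natDegree_le hp).trans_lt (by exact_mod_cast Nat.lt_succ_self d)
  rw [Lagrange.eq_interpolate hinj hdeg, Lagrange.interpolate_apply, Polynomial.eval_finsetSum]
  refine (Finset.abs_sum_le_sum_abs _ _).trans ?_
  rw [← sum_inv_factorial_mul_factorial, Finset.mul_sum, Finset.mul_sum]
  refine Finset.sum_le_sum fun i hi => ?_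
  rw [Polynomial.eval_mul, Polynomial.eval_C, abs_mul]
  exact mul_le_mul (hA i (by simpa [Nat.lt_succ_iff] using hi)) (hbasis i hi) (abs_nonneg _) hA0

/-- A Remez inequality with constant `2e`: the size of a polynomial at a point `x` is controlled by
its size on a set `S` and by the ratio of the distance from `x` to the measure of `S`. -/
theorem Polynomial.remez {p : Polynomial ℝ} {d : ℕ} (hd : d ≠ 0) (hp : p.natDegree ≤ d)
    {S : Set ℝ} (hS : BddBelow S) {a R x : ℝ} (ha : 0 ≤ a)
    (hpa : ∀ y ∈ S, |p.eval y| ≤ a ^ d) (hR : ∀ y ∈ S, |x - y| ≤ R) :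
    volume S * ENNReal.ofReal (|p.eval x| ^ (d : ℝ)⁻¹) ≤
      ENNReal.ofReal (2 * Real.exp 1 * a * R) := by
  set G := |p.eval x| ^ (d : ℝ)⁻¹ with hG
  have hG0 : 0 ≤ G := by positivity
  by_contra! hcon
  have hGpos : 0 < G := by
    rcases hG0.eq_or_lt with h0 | h0
    · simp [← h0] at hcon
    · exact h0
  have hne : S.Nonempty := by
    rw [Set.nonempty_iff_ne_empty]; rintro rfl; simp at hcon
  have hR0 : 0 ≤ R := (abs_nonneg _).trans (hR _ hne.some_mem)
  have h1 : ENNReal.ofReal (2 * Real.exp 1 * a * R / G) < volume S := by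
    rw [ENNReal.ofReal_div_of_pos hGpos]
    refine ENNReal.div_lt_of_lt_mul hcon
  obtain ⟨r, hr0, hr1, hr2⟩ := ENNReal.lt_iff_exists_real_btwn.1 h1
  have hr3 : 2 * Real.exp 1 * a * R / G < r :=
    (ENNReal.ofReal_lt_ofReal_iff_of_nonneg (by positivity)).1 hr1
  have hrpos : 0 < r := lt_of_le_of_lt (by positivity) hr3
  have hd' : (0 : ℝ) < d := by positivity
  obtain ⟨y, hyS, hy⟩ := exists_separated_points (h := r / d) (by positivity) d hS
    (by rwa [mul_div_cancel₀ _ hd'.ne'])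
  have h2 := abs_eval_le_of_separated hp (by positivity) hy (fun i hi => hpa _ (hyS i hi))
    (fun i hi => hR _ (hyS i hi))
  have h3 : |p.eval x| ≤ (2 * Real.exp 1 * a * R / r) ^ d := by
    refine h2.trans ?_
    have h4 := Real.pow_div_factorial_le_exp (d : ℝ) hd'.le d
    have h5 : Real.exp d = Real.exp 1 ^ d := by rw [← Real.exp_nat_mul, mul_one]
    calc a ^ d * ((R / (r / d)) ^ d * (2 ^ d / d.factorial))
        = (2 * a * R / r) ^ d * ((d : ℝ) ^ d / d.factorial) := by
          simp only [div_pow, mul_pow]; field_simp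
      _ ≤ (2 * a * R / r) ^ d * Real.exp 1 ^ d := by rw [← h5]; gcongr
      _ = _ := by rw [← mul_pow]; congr 1; ring
  have h6 : G ≤ 2 * Real.exp 1 * a * R / r := by
    rw [hG]
    calc _ ≤ ((2 * Real.exp 1 * a * R / r) ^ d) ^ (d : ℝ)⁻¹ := by gcongr
      _ = _ := Real.pow_rpow_inv_natCast (by positivity) hd
  rw [div_lt_iff₀ hGpos] at hr3
  rw [le_div_iff₀ hrpos] at h6
  linarith

theorem lintegral_eq_lintegral_Ioi_add_lintegral_Ioi_neg {h : ℝ → ENNReal} (hh : Measurable h) :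
    ∫⁻ t, h t = (∫⁻ t in Set.Ioi 0, h t) + ∫⁻ t in Set.Ioi 0, h (-t) := by
  have h1 := (Measure.measurePreserving_neg (volume : Measure ℝ)).setLIntegral_comp_preimage
    (measurableSet_Iio (a := (0 : ℝ))) hh
  have h2 : Neg.neg ⁻¹' Set.Iio (0 : ℝ) = Set.Ioi 0 := by ext; simp
  rw [h2] at h1
  rw [h1, ← lintegral_add_compl h measurableSet_Ioi (A := Set.Ioi (0 : ℝ)), Set.compl_Ioi,
    setLIntegral_congr Iio_ae_eq_Iic]

theorem mul_lintegral_Ioi_mul_le {f : ℝ → ENNReal} (hf : Measurable f) {c : ENNReal}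
    (H : ∀ r s, 0 < r → 0 < s → c * f (r + s) ≤ f r * f s) :
    c * ∫⁻ t in Set.Ioi 0, ENNReal.ofReal t * f t ≤ (∫⁻ t in Set.Ioi 0, f t) ^ 2 := by
  have h1 : ∫⁻ t in Set.Ioi 0, ENNReal.ofReal t * f t =
      ∫⁻ r in Set.Ioi 0, ∫⁻ s in Set.Ioi 0, f (r + s) := by
    have h2 : ∀ t : ℝ, ENNReal.ofReal t * f t =
        ∫⁻ r in Set.Ioi (0 : ℝ), (Set.Ioi r).indicator f t := by
      intro t
      have : ∀ r, (Set.Ioi r).indicator f t = (Set.Iio t).indicator (fun _ => f t) r := by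
        intro r; simp [Set.indicator_apply]
      simp only [this]
      rw [lintegral_indicator measurableSet_Iio, setLIntegral_const,
        Measure.restrict_apply measurableSet_Iio, Set.inter_comm, Set.Ioi_inter_Iio,
        Real.volume_Ioo, sub_zero, mul_comm]
    have hm : Measurable (Function.uncurry fun t r : ℝ => (Set.Ioi r).indicator f t) := by
      have : (Function.uncurry fun t r : ℝ => (Set.Ioi r).indicator f t) =
          {p : ℝ × ℝ | p.2 < p.1}.indicator fun p => f p.1 := by
        ext ⟨t, r⟩; simp [Set.indicator_apply]
      rw [this]
      exact (hf.comp measurable_fst).indicator (measurableSet_lt measurable_snd measurable_fst)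
    simp only [h2]
    rw [lintegral_lintegral_swap hm.aemeasurable]
    refine setLIntegral_congr_fun measurableSet_Ioi fun r hr => ?_
    rw [lintegral_indicator measurableSet_Ioi, Measure.restrict_restrict measurableSet_Ioi,
      Set.inter_eq_left.2 (Set.Ioi_subset_Ioi (le_of_lt hr)),
      ← (measurePreserving_add_left volume r).setLIntegral_comp_preimage measurableSet_Ioi hf]
    congr 2
    ext; simp
  have hm2 : Measurable fun r => ∫⁻ s in Set.Ioi 0, f (r + s) :=
    (hf.comp (measurable_fst.add measurable_snd)).lintegral_prod_right'
  rw [h1, ← lintegral_const_mul _ hm2, sq, ← lintegral_mul_const _ hf]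
  refine setLIntegral_mono' measurableSet_Ioi fun r hr => ?_
  rw [← lintegral_const_mul _ (by fun_prop), ← lintegral_const_mul _ hf]
  exact setLIntegral_mono' measurableSet_Ioi fun s hs => H r s hr hs

theorem mul_le_mul_of_logConcave {w : ℝ → ENNReal}
    (hw : ∀ a b s, 0 < s → s < 1 → w a ^ (1 - s) * w b ^ s ≤ w ((1 - s) * a + s * b))
    (m e r s : ℝ) (hr : 0 < r) (hs : 0 < s) :
    w m * w (m + e * (r + s)) ≤ w (m + e * r) * w (m + e * s) := by
  have h0 : 0 < r + s := by positivity
  have key : ∀ a b : ENNReal, ∀ u : ℝ, 0 ≤ u → u ≤ 1 →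
      a * b = (a ^ (1 - u) * b ^ u) * (a ^ u * b ^ (1 - u)) := by
    intro a b u hu hu1
    rw [mul_mul_mul_comm, ← ENNReal.rpow_add_of_nonneg _ _ (by linarith) hu,
      ← ENNReal.rpow_add_of_nonneg _ _ hu (by linarith)]
    simp
  have hu0 : 0 < r / (r + s) := by positivity
  have hu1 : r / (r + s) < 1 := by rw [div_lt_one h0]; linarith
  rw [key _ _ (r / (r + s)) hu0.le hu1.le]
  have e1 := hw m (m + e * (r + s)) _ hu0 hu1
  have e2 := hw m (m + e * (r + s)) (1 - r / (r + s)) (by linarith) (by linarith)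
  rw [sub_sub_cancel] at e2
  refine mul_le_mul' (e1.trans (le_of_eq ?_)) (e2.trans (le_of_eq ?_)) <;> congr 1 <;> field_simp <;>
    ring

/-- For a log-concave function `w`, the first absolute moment around any point `m` is controlled by
the total mass. -/
theorem mul_lintegral_abs_sub_mul_le {w : ℝ → ENNReal} (hwm : Measurable w)
    (hw : ∀ a b s, 0 < s → s < 1 → w a ^ (1 - s) * w b ^ s ≤ w ((1 - s) * a + s * b)) (m : ℝ) :
    w m * ∫⁻ x, ENNReal.ofReal |x - m| * w x ≤ (∫⁻ x, w x) ^ 2 := by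
  rw [← lintegral_add_left_eq_self (fun x => ENNReal.ofReal |x - m| * w x) m,
    ← lintegral_add_left_eq_self w m,
    lintegral_eq_lintegral_Ioi_add_lintegral_Ioi_neg (by fun_prop),
    lintegral_eq_lintegral_Ioi_add_lintegral_Ioi_neg (h := fun x => w (m + x)) (by fun_prop), mul_add]
  have h1 := mul_lintegral_Ioi_mul_le (f := fun t => w (m + t)) (by fun_prop) (c := w m)
    fun r s hr hs => by simpa using mul_le_mul_of_logConcave hw m 1 r s hr hs
  have h2 := mul_lintegral_Ioi_mul_le (f := fun t => w (m + -t)) (by fun_prop) (c := w m)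
    fun r s hr hs => by simpa using mul_le_mul_of_logConcave hw m (-1) r s hr hs
  have e1 : ∫⁻ t in Set.Ioi 0, ENNReal.ofReal |m + t - m| * w (m + t) =
      ∫⁻ t in Set.Ioi 0, ENNReal.ofReal t * w (m + t) :=
    setLIntegral_congr_fun measurableSet_Ioi fun t ht => by
      simp [abs_of_pos (show (0 : ℝ) < t from ht)]
  have e2 : ∫⁻ t in Set.Ioi 0, ENNReal.ofReal |m + -t - m| * w (m + -t) =
      ∫⁻ t in Set.Ioi 0, ENNReal.ofReal t * w (m + -t) :=
    setLIntegral_congr_fun measurableSet_Ioi fun t ht => by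
      simp [abs_of_pos (show (0 : ℝ) < t from ht)]
  rw [e1, e2]
  refine (add_le_add h1 h2).trans ?_
  rw [add_sq, add_right_comm]
  exact le_self_add

theorem lintegral_eq_lintegral_Ioo_meas_lt {μ : Measure ℝ} {w : ℝ → ENNReal} (hwm : Measurable w)
    {c : ENNReal} (hc : c ≠ ⊤) (hwc : ∀ t, w t ≤ c) :
    ∫⁻ x, w x ∂μ = ∫⁻ u in Set.Ioo 0 c.toReal, μ {x | ENNReal.ofReal u < w x} := by
  have hset : ∀ u : ℝ, 0 < u → {x | ENNReal.ofReal u < w x} = {x | u < (w x).toReal} := by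
    intro u hu
    ext x
    exact ENNReal.ofReal_lt_iff_lt_toReal hu.le ((hwc x).trans_lt hc.lt_top).ne
  have h1 := lintegral_eq_lintegral_meas_lt μ (f := fun x => (w x).toReal)
    (Filter.Eventually.of_forall fun x => ENNReal.toReal_nonneg) (by fun_prop)
  have h2 : ∀ x, ENNReal.ofReal (w x).toReal = w x := fun x =>
    ENNReal.ofReal_toReal ((hwc x).trans_lt hc.lt_top).ne
  simp only [h2] at h1
  rw [h1]
  rcases ENNReal.toReal_nonneg (a := c) |>.eq_or_lt with h0 | h0
  · rw [← h0, Set.Ioo_self, Measure.restrict_empty, lintegral_zero_measure,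
      setLIntegral_congr_fun (g := fun _ => 0) measurableSet_Ioi, lintegral_zero]
    intro u hu
    have : {x | u < (w x).toReal} = ∅ := by
      ext x
      have := ENNReal.toReal_mono hc (hwc x)
      have := Set.mem_Ioi.1 hu
      simp only [Set.mem_ofPred_eq, Set.mem_empty_iff_false, iff_false, not_lt]
      linarith
    simp [this]
  rw [← Set.Ioo_union_Ici_eq_Ioi h0, lintegral_union measurableSet_Ici
    (Set.disjoint_left.2 fun x hx hx' => absurd hx.2 (not_lt.2 hx'))]
  rw [setLIntegral_congr_fun (s := Set.Ici c.toReal) (g := fun _ => 0) measurableSet_Ici,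
    lintegral_zero, add_zero]
  · exact setLIntegral_congr_fun measurableSet_Ioo fun t ht => by
      simp only [hset t ht.1]
  · intro u hu
    have : {x | u < (w x).toReal} = ∅ := by
      ext x
      have := ENNReal.toReal_mono hc (hwc x)
      have := Set.mem_Ici.1 hu
      simp only [Set.mem_ofPred_eq, Set.mem_empty_iff_false, iff_false, not_lt]
      linarith
    simp [this]

theorem ofReal_abs_sub_le_volume_superlevel {w : ℝ → ENNReal}
    (hw : ∀ a b s, 0 < s → s < 1 → w a ^ (1 - s) * w b ^ s ≤ w ((1 - s) * a + s * b))
    {m : ℝ} (hm : ∀ t, w t ≤ w m) {c : ENNReal} {y : ℝ} (hy : c < w y) :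
    ENNReal.ofReal |y - m| ≤ volume {t | c < w t} := by
  rw [← Real.volume_interval]
  refine measure_mono ?_
  rw [← segment_eq_uIcc, segment_eq_image]
  rintro _ ⟨s, ⟨hs0, hs1⟩, rfl⟩
  simp only [smul_eq_mul, Set.mem_ofPred_eq]
  rcases hs0.eq_or_lt with rfl | hs0
  · simpa using hy.trans_le (hm y)
  rcases hs1.eq_or_lt with rfl | hs1
  · simpa using hy
  refine hy.trans_le (le_trans ?_ (hw m y s hs0 hs1))
  calc w y = w y ^ (1 - s) * w y ^ s := by
        rw [← ENNReal.rpow_add_of_nonneg _ _ (by linarith) hs0.le]; simp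
    _ ≤ _ := by gcongr; exact hm y

theorem Polynomial.mul_setLIntegral_le_of_logConcave {p : Polynomial ℝ} {d : ℕ} (hd : d ≠ 0)
    (hp : p.natDegree ≤ d) {w : ℝ → ENNReal} (hwm : Measurable w)
    (hw : ∀ a b s, 0 < s → s < 1 → w a ^ (1 - s) * w b ^ s ≤ w ((1 - s) * a + s * b))
    {m : ℝ} (hm : ∀ t, w t ≤ w m) (hmt : w m ≠ ⊤) (hV : ∫⁻ x, w x ≠ ⊤) {a : ℝ} (ha : 0 ≤ a)
    (x : ℝ) :
    ENNReal.ofReal (|p.eval x| ^ (d : ℝ)⁻¹) * ∫⁻ y in {y | |p.eval y| ≤ a ^ d}, w y ≤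
      ENNReal.ofReal (2 * Real.exp 1 * a) * (w m * ENNReal.ofReal |x - m| + ∫⁻ y, w y) := by
  set D := {y | |p.eval y| ≤ a ^ d} with hD
  have hDm : MeasurableSet D := measurableSet_le (by fun_prop) measurable_const
  set G := |p.eval x| ^ (d : ℝ)⁻¹
  have hmeas : ∀ μ : Measure ℝ, Measurable fun u : ℝ => μ {t | ENNReal.ofReal u < w t} := fun μ =>
    Antitone.measurable fun u v huv => measure_mono fun t ht =>
      lt_of_le_of_lt (ENNReal.ofReal_le_ofReal huv) ht
  have hone : w m = ∫⁻ _u in Set.Ioo 0 (w m).toReal, 1 := by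
    rw [setLIntegral_const, Real.volume_Ioo, sub_zero, one_mul, ENNReal.ofReal_toReal hmt]
  have hpt : ∀ u ∈ Set.Ioo 0 (w m).toReal,
      ENNReal.ofReal G * volume.restrict D {t | ENNReal.ofReal u < w t} ≤
        ENNReal.ofReal (2 * Real.exp 1 * a) *
          (ENNReal.ofReal |x - m| + volume {t | ENNReal.ofReal u < w t}) := by
    intro u hu
    set J := {t | ENNReal.ofReal u < w t} with hJ
    have hJt : volume J ≠ ⊤ := by
      have h1 := meas_ge_le_lintegral_div (μ := volume) hwm.aemeasurable
        (ENNReal.ofReal_pos.2 hu.1).ne' ENNReal.ofReal_ne_top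
      have h3 : volume J ≤ volume {t | ENNReal.ofReal u ≤ w t} :=
        measure_mono fun t (ht : ENNReal.ofReal u < w t) => ht.le
      refine (h3.trans_lt (h1.trans_lt ?_)).ne
      exact ENNReal.div_lt_top hV (ENNReal.ofReal_pos.2 hu.1).ne'
    have hJd : ∀ y ∈ J, |y - m| ≤ (volume J).toReal := fun y hy =>
      (ENNReal.ofReal_le_iff_le_toReal hJt).1 (ofReal_abs_sub_le_volume_superlevel hw hm hy)
    have hJm : MeasurableSet J := measurableSet_lt measurable_const hwm
    rw [Measure.restrict_apply hJm, mul_comm]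
    have h2 := Polynomial.remez hd hp (S := J ∩ D) (x := x) (R := |x - m| + (volume J).toReal)
      ⟨m - (volume J).toReal, fun y hy => by have := abs_le.1 (hJd y hy.1); linarith⟩ ha
      (fun y hy => hy.2) (fun y hy => by
        have := hJd y hy.1
        have := abs_sub_le x m y
        rw [abs_sub_comm m y] at this
        linarith)
    refine h2.trans (le_of_eq ?_)
    rw [ENNReal.ofReal_mul (by positivity), ENNReal.ofReal_add (abs_nonneg _)
      ENNReal.toReal_nonneg, ENNReal.ofReal_toReal hJt]
  rw [lintegral_eq_lintegral_Ioo_meas_lt hwm hmt hm, ← lintegral_const_mul _ (hmeas _)]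
  refine (setLIntegral_mono' measurableSet_Ioo hpt).trans (le_of_eq ?_)
  rw [lintegral_const_mul _ ((hmeas _).const_add _), lintegral_add_left measurable_const,
    ← lintegral_eq_lintegral_Ioo_meas_lt hwm hmt hm, setLIntegral_const, Real.volume_Ioo, sub_zero,
    ENNReal.ofReal_toReal hmt, mul_comm (w m)]

/-- Distributional inequality for polynomials with respect to a log-concave weight on the line. -/
theorem Polynomial.lintegral_mul_setLIntegral_le_of_logConcave {p : Polynomial ℝ} {d : ℕ}
    (hd : d ≠ 0) (hp : p.natDegree ≤ d) {w : ℝ → ENNReal} (hwm : Measurable w)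
    (hw : ∀ a b s, 0 < s → s < 1 → w a ^ (1 - s) * w b ^ s ≤ w ((1 - s) * a + s * b))
    {m : ℝ} (hm : ∀ t, w t ≤ w m) (hmt : w m ≠ ⊤) (hV : ∫⁻ x, w x ≠ ⊤) {a : ℝ} (ha : 0 ≤ a) :
    (∫⁻ x, ENNReal.ofReal (|p.eval x| ^ (d : ℝ)⁻¹) * w x) *
        ∫⁻ y in {y | |p.eval y| ≤ a ^ d}, w y ≤
      ENNReal.ofReal (4 * Real.exp 1 * a) * (∫⁻ y, w y) ^ 2 := by
  rw [← lintegral_mul_const _ (by fun_prop)]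
  calc _ ≤ ∫⁻ x, ENNReal.ofReal (2 * Real.exp 1 * a) *
        (w m * (ENNReal.ofReal |x - m| * w x) + (∫⁻ y, w y) * w x) := by
        refine lintegral_mono fun x => ?_
        have := mul_le_mul_left
          (Polynomial.mul_setLIntegral_le_of_logConcave hd hp hwm hw hm hmt hV ha x) (w x)
        simp only
        rw [mul_right_comm]
        refine this.trans (le_of_eq ?_)
        ring
    _ = ENNReal.ofReal (2 * Real.exp 1 * a) *
        ((w m * ∫⁻ x, ENNReal.ofReal |x - m| * w x) + (∫⁻ y, w y) * (∫⁻ y, w y)) := by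
        rw [lintegral_const_mul _ (by fun_prop), lintegral_add_left (by fun_prop),
          lintegral_const_mul _ (by fun_prop), lintegral_const_mul _ hwm]
    _ ≤ ENNReal.ofReal (2 * Real.exp 1 * a) * ((∫⁻ y, w y) ^ 2 + (∫⁻ y, w y) ^ 2) := by
        rw [← sq]
        gcongr
        exact mul_lintegral_abs_sub_mul_le hwm hw m
    _ = _ := by
        rw [← two_mul, ← mul_assoc, ← ENNReal.ofReal_ofNat 2, ← ENNReal.ofReal_mul (by positivity)]
        congr 2
        ring

theorem setLIntegral_eq_lintegral_mul_volume_slice {n : ℕ} (i : Fin (n + 1))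
    {S : Set (Fin (n + 1) → ℝ)} (hS : MeasurableSet S) {φ : ℝ → ENNReal} (hφ : Measurable φ) :
    ∫⁻ x in S, φ (x i) = ∫⁻ t, φ t * volume {y : Fin n → ℝ | i.insertNth t y ∈ S} := by
  have h0 : Measurable (S.indicator fun x : Fin (n + 1) → ℝ => φ (x i)) :=
    (hφ.comp (measurable_pi_apply i)).indicator hS
  rw [← lintegral_indicator hS, lintegral_eq_lintegral_insertNth i h0]
  refine lintegral_congr fun t => ?_
  have h1 : MeasurableSet {y : Fin n → ℝ | i.insertNth t y ∈ S} :=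
    (measurable_insertNth i).comp measurable_prodMk_left hS
  rw [← setLIntegral_const, ← lintegral_indicator h1]
  refine lintegral_congr fun y => ?_
  by_cases hy : i.insertNth t y ∈ S
  · rw [Set.indicator_of_mem hy, Set.indicator_of_mem (by exact hy), Fin.insertNth_apply_same]
  · rw [Set.indicator_of_notMem hy, Set.indicator_of_notMem (by exact hy)]

theorem measurable_volume_slice {n : ℕ} (i : Fin (n + 1)) {S : Set (Fin (n + 1) → ℝ)}
    (hS : MeasurableSet S) :
    Measurable fun t : ℝ => volume {y : Fin n → ℝ | i.insertNth t y ∈ S} :=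
  measurable_measure_prodMk_left (measurable_insertNth i hS)

theorem volume_slice_logConcave {n : ℕ} (i : Fin (n + 1)) {S : Set (Fin (n + 1) → ℝ)}
    (hS : MeasurableSet S) (hSc : Convex ℝ S) (a b s : ℝ) (hs0 : 0 < s) (hs1 : s < 1) :
    volume {y : Fin n → ℝ | i.insertNth a y ∈ S} ^ (1 - s) *
        volume {y : Fin n → ℝ | i.insertNth b y ∈ S} ^ s ≤
      volume {y : Fin n → ℝ | i.insertNth ((1 - s) * a + s * b) y ∈ S} := by
  have hm : ∀ t : ℝ, MeasurableSet {y : Fin n → ℝ | i.insertNth t y ∈ S} := fun t =>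
    (measurable_insertNth i).comp measurable_prodMk_left hS
  have h1 := prekopa_leindler
    (f := {y : Fin n → ℝ | i.insertNth a y ∈ S}.indicator 1)
    (g := {y : Fin n → ℝ | i.insertNth b y ∈ S}.indicator 1)
    (h := {y : Fin n → ℝ | i.insertNth ((1 - s) * a + s * b) y ∈ S}.indicator 1)
    (measurable_one.indicator (hm _)) (measurable_one.indicator (hm _))
    (measurable_one.indicator (hm _)) hs0 hs1 fun x y => by
      by_cases hx : i.insertNth a x ∈ S
      · by_cases hy : i.insertNth b y ∈ S
        · have h3 := hSc hx hy (sub_pos.2 hs1).le hs0.le (by ring)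
          rw [insertNth_weighted_sum] at h3
          rw [Set.indicator_of_mem (by exact hx), Set.indicator_of_mem (by exact hy),
            Set.indicator_of_mem (by exact h3)]
          simp
        · simp [hy, hs0]
      · simp [hx, hs1]
  simpa [lintegral_indicator_one, hm] using h1

theorem upperSemicontinuous_volume_slice {n : ℕ} (i : Fin (n + 1)) {S : Set (Fin (n + 1) → ℝ)}
    (hS : IsCompact S) :
    UpperSemicontinuous fun t : ℝ => volume {y : Fin n → ℝ | i.insertNth t y ∈ S} := by
  intro t c hc
  obtain ⟨U, hU, hUo, hUc⟩ := Set.exists_isOpen_lt_of_lt _ _ hc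
  have hcont : Continuous fun p : Fin (n + 1) → ℝ => i.removeNth p := by
    unfold Fin.removeNth; fun_prop
  have hK : IsCompact ((fun p : Fin (n + 1) → ℝ => p i) '' (S ∩ (fun p => i.removeNth p) ⁻¹' Uᶜ)) :=
    (hS.inter_right (hUo.isClosed_compl.preimage hcont)).image (continuous_apply i)
  have ht : t ∈ ((fun p : Fin (n + 1) → ℝ => p i) '' (S ∩ (fun p => i.removeNth p) ⁻¹' Uᶜ))ᶜ := by
    rintro ⟨p, ⟨hp, hpU⟩, hpt⟩
    refine hpU (hU ?_)
    simp only at hpt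
    rw [← hpt, Set.mem_ofPred_eq, Fin.insertNth_self_removeNth]
    exact hp
  filter_upwards [hK.isClosed.isOpen_compl.mem_nhds ht] with t' ht'
  refine lt_of_le_of_lt (measure_mono fun y hy => ?_) hUc
  by_contra hyU
  exact ht' ⟨i.insertNth t' y, ⟨hy, by simpa using hyU⟩, by simp⟩

theorem exists_volume_slice_le {n : ℕ} (i : Fin (n + 1)) {S : Set (Fin (n + 1) → ℝ)}
    (hS : IsCompact S) :
    ∃ m : ℝ, ∀ t : ℝ, volume {y : Fin n → ℝ | i.insertNth t y ∈ S} ≤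
      volume {y : Fin n → ℝ | i.insertNth m y ∈ S} := by
  rcases S.eq_empty_or_nonempty with rfl | hne
  · simp
  obtain ⟨m, -, hm⟩ := (upperSemicontinuous_volume_slice i hS).upperSemicontinuousOn
    ((fun p : Fin (n + 1) → ℝ => p i) '' S) |>.exists_isMaxOn (hne.image _)
    (hS.image (continuous_apply i))
  refine ⟨m, fun t => ?_⟩
  by_cases ht : t ∈ (fun p : Fin (n + 1) → ℝ => p i) '' S
  · exact hm ht
  · have : {y : Fin n → ℝ | i.insertNth t y ∈ S} = ∅ := by
      ext y
      simp only [Set.mem_ofPred_eq, Set.mem_empty_iff_false, iff_false]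
      exact fun hy => ht ⟨_, hy, by simp⟩
    simp [this]

/-- Distributional inequality on a convex body, for a polynomial in a single coordinate. -/
theorem Polynomial.setLIntegral_mul_volume_le {n : ℕ} (i : Fin (n + 1))
    {S : Set (Fin (n + 1) → ℝ)} (hS : IsCompact S) (hSc : Convex ℝ S) {p : Polynomial ℝ} {d : ℕ}
    (hd : d ≠ 0) (hp : p.natDegree ≤ d) {a : ℝ} (ha : 0 ≤ a) :
    (∫⁻ x in S, ENNReal.ofReal (|p.eval (x i)| ^ (d : ℝ)⁻¹)) *
        volume (S ∩ {x | |p.eval (x i)| ≤ a ^ d}) ≤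
      ENNReal.ofReal (4 * Real.exp 1 * a) * volume S ^ 2 := by
  have hSm := hS.measurableSet
  obtain ⟨m, hm⟩ := exists_volume_slice_le i hS
  have hD : MeasurableSet {t : ℝ | |p.eval t| ≤ a ^ d} :=
    measurableSet_le (by fun_prop) measurable_const
  have hV : ∫⁻ t, volume {y : Fin n → ℝ | i.insertNth t y ∈ S} = volume S := by
    have := setLIntegral_eq_lintegral_mul_volume_slice i hSm (φ := fun _ => 1) measurable_const
    simpa using this.symm
  have hmt : volume {y : Fin n → ℝ | i.insertNth m y ∈ S} ≠ ⊤ := by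
    refine ((measure_mono ?_).trans_lt
      (hS.image (f := fun p : Fin (n + 1) → ℝ => i.removeNth p) ?_).measure_lt_top).ne
    · exact fun y hy => ⟨_, hy, by simp⟩
    · unfold Fin.removeNth; fun_prop
  have h1 := Polynomial.lintegral_mul_setLIntegral_le_of_logConcave hd hp
    (measurable_volume_slice i hSm) (volume_slice_logConcave i hSm hSc) hm hmt
    (hV ▸ hS.measure_lt_top.ne) ha
  have h2 : volume (S ∩ {x | |p.eval (x i)| ≤ a ^ d}) =
      ∫⁻ t in {t | |p.eval t| ≤ a ^ d}, volume {y : Fin n → ℝ | i.insertNth t y ∈ S} := by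
    have h3 := setLIntegral_eq_lintegral_mul_volume_slice i hSm
      (φ := {t : ℝ | |p.eval t| ≤ a ^ d}.indicator 1) (measurable_one.indicator hD)
    have h4 : MeasurableSet {x : Fin (n + 1) → ℝ | |p.eval (x i)| ≤ a ^ d} :=
      hD.preimage (measurable_pi_apply i)
    rw [← lintegral_indicator hD]
    simp only [Set.indicator_apply, Set.mem_ofPred_eq, Pi.one_apply, ite_mul, one_mul, zero_mul] at h3 ⊢
    rw [← h3]
    rw [Set.inter_comm, ← Measure.restrict_apply h4, ← lintegral_indicator_one h4]
    rfl
  rw [hV] at h1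
  rw [h2, setLIntegral_eq_lintegral_mul_volume_slice i hSm
    (φ := fun t => ENNReal.ofReal (|p.eval t| ^ (d : ℝ)⁻¹)) (by fun_prop)]
  exact h1

theorem volume_hyperplane_eq_zero {n : ℕ} {i j : Fin n} (hij : i ≠ j) {α β : ℝ}
    (h : α ≠ 0 ∨ β ≠ 0) (c₁ c₂ : ℝ) :
    volume {x : Fin n → ℝ | α * (x i - c₁) + β * (x j - c₂) = 0} = 0 := by
  set φ : (Fin n → ℝ) →ₗ[ℝ] ℝ := α • LinearMap.proj i + β • LinearMap.proj j with hφ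
  have hφx : ∀ x, φ x = α * x i + β * x j := fun x => by simp [hφ]
  have hker : LinearMap.ker φ ≠ ⊤ := by
    intro htop
    rw [LinearMap.ker_eq_top] at htop
    have h1 := hφx (Pi.single i 1)
    have h2 := hφx (Pi.single j 1)
    simp [htop, hij, hij.symm] at h1 h2
    rcases h with h | h
    · exact h h1.symm
    · exact h h2.symm
  rcases Set.eq_empty_or_nonempty {x : Fin n → ℝ | α * (x i - c₁) + β * (x j - c₂) = 0} with h0 | ⟨y, hy⟩
  · rw [h0, measure_empty]
  have : {x : Fin n → ℝ | α * (x i - c₁) + β * (x j - c₂) = 0} =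
      (fun x => x + -y) ⁻¹' (LinearMap.ker φ : Set (Fin n → ℝ)) := by
    ext x
    simp only [Set.mem_ofPred_eq] at hy
    simp only [Set.mem_ofPred_eq, Set.mem_preimage, SetLike.mem_coe, LinearMap.mem_ker, hφx,
      Pi.add_apply, Pi.neg_apply]
    constructor <;> intro h <;> linarith
  rw [this, measure_preimage_add_right]
  exact Measure.addHaar_submodule _ _ hker

/-- A convex body on which `u` has zero mean and in which `D` has density larger than `η`. -/
structure IsBalancedBody {n : ℕ} (u : (Fin n → ℝ) → ℝ) (D : Set (Fin n → ℝ)) (η : ℝ)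
    (F : Set (Fin n → ℝ)) : Prop where
  isCompact : IsCompact F
  convex : Convex ℝ F
  integral_eq_zero : ∫ x in F, u x = 0
  lt_volume_inter : η * volume.real F < volume.real (F ∩ D)

theorem IsBalancedBody.exists_bisection {n : ℕ} {u : (Fin n → ℝ) → ℝ} (hu : Continuous u)
    {D : Set (Fin n → ℝ)} {η : ℝ} {F : Set (Fin n → ℝ)} (hF : IsBalancedBody u D η F)
    {i j : Fin n} (hij : i ≠ j) (c₁ c₂ : ℝ) :
    ∃ F' ⊆ F, IsBalancedBody u D η F' ∧ ∃ α β : ℝ, (α ≠ 0 ∨ β ≠ 0) ∧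
      ∀ x ∈ F', 0 ≤ α * (x i - c₁) + β * (x j - c₂) := by
  set L : ℝ → (Fin n → ℝ) → ℝ := fun θ x => Real.cos θ * (x i - c₁) + Real.sin θ * (x j - c₂)
    with hL
  have hLc : ∀ θ, Continuous (L θ) := fun θ => by simp only [hL]; fun_prop
  have hLθ : ∀ x, Continuous fun θ => L θ x := fun x => by simp only [hL]; fun_prop
  have hcs : ∀ θ : ℝ, Real.cos θ ≠ 0 ∨ Real.sin θ ≠ 0 := by
    intro θ
    by_contra! h
    have := Real.sin_sq_add_cos_sq θ
    simp [h.1, h.2] at this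
  have hnull : ∀ θ, volume {x | L θ x = 0} = 0 := fun θ =>
    volume_hyperplane_eq_zero hij (hcs θ) c₁ c₂
  have hint : IntegrableOn u F := hu.continuousOn.integrableOn_compact hF.isCompact
  have hHm : ∀ θ, MeasurableSet {x | 0 ≤ L θ x} := fun θ =>
    measurableSet_le measurable_const (hLc θ).measurable
  have hpi : ∀ θ x, L (θ + Real.pi) x = -L θ x := fun θ x => by
    simp only [hL, Real.cos_add_pi, Real.sin_add_pi]; ring
  have hcompl : ∀ θ, ({x | 0 ≤ L (θ + Real.pi) x} : Set (Fin n → ℝ)) =ᵐ[volume]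
      ({x | 0 ≤ L θ x}ᶜ : Set (Fin n → ℝ)) := by
    intro θ
    have : ∀ᵐ x, L θ x ≠ 0 := by rw [ae_iff]; simpa using hnull θ
    filter_upwards [this] with x hx
    apply propext
    change 0 ≤ L (θ + Real.pi) x ↔ ¬ 0 ≤ L θ x
    rw [hpi, not_le, neg_nonneg]
    exact ⟨fun h => lt_of_le_of_ne h hx, le_of_lt⟩
  have hcompl' : ∀ θ, ∀ S : Set (Fin n → ℝ),
      (S ∩ {x | 0 ≤ L (θ + Real.pi) x} : Set (Fin n → ℝ)) =ᵐ[volume]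
        (S \ {x | 0 ≤ L θ x} : Set (Fin n → ℝ)) := by
    intro θ S
    rw [Set.sdiff_eq]
    exact ae_eq_set_inter (Filter.EventuallyEq.refl _ _) (hcompl θ)
  set h : ℝ → ℝ := fun θ => ∫ x in F, {x | 0 ≤ L θ x}.indicator u x with hh
  have hh' : ∀ θ, h θ = ∫ x in F ∩ {x | 0 ≤ L θ x}, u x := fun θ => setIntegral_indicator (hHm θ)
  have hcont : Continuous h := by
    refine continuous_iff_continuousAt.2 fun θ => ?_
    refine continuousAt_of_dominated (bound := fun x => ‖u x‖)
      (Filter.Eventually.of_forall fun θ' => (hu.measurable.indicator (hHm θ')).aestronglyMeasurable)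
      (Filter.Eventually.of_forall fun θ' => Filter.Eventually.of_forall fun x =>
        norm_indicator_le_norm_self _ _) hint.norm ?_
    have : ∀ᵐ x, L θ x ≠ 0 := by rw [ae_iff]; simpa using hnull θ
    filter_upwards [ae_restrict_of_ae this] with x hx
    rcases lt_or_gt_of_ne hx with hx | hx
    · have := (hLθ x).continuousAt.eventually_lt continuousAt_const hx
      refine (continuousAt_const (y := (0 : ℝ))).congr ?_
      filter_upwards [this] with θ' hθ'
      exact (Set.indicator_of_notMem (by exact not_le.2 hθ') _).symm
    · have := continuousAt_const.eventually_lt (hLθ x).continuousAt hx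
      refine (continuousAt_const (y := u x)).congr ?_
      filter_upwards [this] with θ' hθ'
      exact (Set.indicator_of_mem (by exact hθ'.le) _).symm
  have hsum : ∀ θ, h θ + h (θ + Real.pi) = 0 := by
    intro θ
    rw [hh', hh', setIntegral_congr_set (hcompl' θ F), integral_inter_add_sdiff (hHm θ) hint,
      hF.integral_eq_zero]
  obtain ⟨θ, hθ⟩ : ∃ θ, h θ = 0 := by
    have h0 := hsum 0
    rw [zero_add] at h0
    have hmem : (0 : ℝ) ∈ Set.uIcc (h 0) (h Real.pi) := by
      rw [Set.mem_uIcc]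
      rcases le_total (h 0) 0 with h1 | h1
      · left; constructor <;> linarith
      · right; constructor <;> linarith
    obtain ⟨θ, -, hθ⟩ := intermediate_value_uIcc hcont.continuousOn hmem
    exact ⟨θ, hθ⟩
  have hθ' : h (θ + Real.pi) = 0 := by linarith [hsum θ]
  have hbody : ∀ θ, h θ = 0 → η * volume.real (F ∩ {x | 0 ≤ L θ x}) <
      volume.real ((F ∩ {x | 0 ≤ L θ x}) ∩ D) →
      ∃ F' ⊆ F, IsBalancedBody u D η F' ∧ ∃ α β : ℝ, (α ≠ 0 ∨ β ≠ 0) ∧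
        ∀ x ∈ F', 0 ≤ α * (x i - c₁) + β * (x j - c₂) := by
    intro θ h0 hlt
    refine ⟨F ∩ {x | 0 ≤ L θ x}, Set.inter_subset_left, ⟨?_, ?_, ?_, hlt⟩, Real.cos θ, Real.sin θ,
      hcs θ, fun x hx => hx.2⟩
    · exact hF.isCompact.inter_right (isClosed_le continuous_const (hLc θ))
    · refine hF.convex.inter fun x hx y hy a b ha hb hab => ?_
      have : L θ (a • x + b • y) = a * L θ x + b * L θ y := by
        simp only [hL, Pi.add_apply, Pi.smul_apply, smul_eq_mul]
        linear_combination (Real.cos θ * c₁ + Real.sin θ * c₂) * hab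
      rw [Set.mem_ofPred_eq, this]
      exact add_nonneg (mul_nonneg ha hx) (mul_nonneg hb hy)
    · rw [← hh', h0]
  by_contra hcon
  have h1 : ¬ _ := fun hlt => hcon (hbody θ hθ hlt)
  have h2 : ¬ _ := fun hlt => hcon (hbody _ hθ' hlt)
  rw [not_lt, Set.inter_right_comm] at h1 h2
  rw [measureReal_congr (hcompl' θ _), measureReal_congr (hcompl' θ _)] at h2
  have h3 := measureReal_inter_add_sdiff (μ := volume) (s := F) (hHm θ) hF.isCompact.measure_lt_top.ne
  have h4 := measureReal_inter_add_sdiff (μ := volume) (s := F ∩ D) (hHm θ)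
    (measure_ne_top_of_subset Set.inter_subset_left hF.isCompact.measure_lt_top.ne)
  have h5 := hF.lt_volume_inter
  rw [← h3, ← h4, mul_add] at h5
  linarith

theorem IsBalancedBody.exists_antitone_seq {n : ℕ} {u : (Fin (n + 1) → ℝ) → ℝ} (hu : Continuous u)
    {D : Set (Fin (n + 1) → ℝ)} {η : ℝ} {F : Set (Fin (n + 1) → ℝ)} (hF : IsBalancedBody u D η F) :
    ∃ S : ℕ → Set (Fin (n + 1) → ℝ), Antitone S ∧ (∀ k, IsBalancedBody u D η (S k)) ∧
      ∀ i j, i ≠ j → ∀ q₁ q₂ : ℚ, ∃ k, ∃ α β : ℝ, (α ≠ 0 ∨ β ≠ 0) ∧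
        ∀ x ∈ S k, 0 ≤ α * (x i - q₁) + β * (x j - q₂) := by
  have hstep : ∀ (G : {G // IsBalancedBody u D η G}) (c : Fin (n + 1) × Fin (n + 1) × ℚ × ℚ),
      ∃ G' : {G // IsBalancedBody u D η G}, G'.1 ⊆ G.1 ∧ (c.1 ≠ c.2.1 → ∃ α β : ℝ,
        (α ≠ 0 ∨ β ≠ 0) ∧ ∀ x ∈ G'.1, 0 ≤ α * (x c.1 - c.2.2.1) + β * (x c.2.1 - c.2.2.2)) := by
    intro G c
    by_cases hc : c.1 = c.2.1
    · exact ⟨G, subset_rfl, fun h => absurd hc h⟩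
    · obtain ⟨G', h1, h2, h3⟩ := G.2.exists_bisection hu hc c.2.2.1 c.2.2.2
      exact ⟨⟨G', h2⟩, h1, fun _ => h3⟩
  choose next hsub hcut using hstep
  obtain ⟨e, he⟩ := exists_surjective_nat (Fin (n + 1) × Fin (n + 1) × ℚ × ℚ)
  set S : ℕ → {G // IsBalancedBody u D η G} := fun k =>
    Nat.rec ⟨F, hF⟩ (fun k G => next G (e k)) k with hS
  refine ⟨fun k => (S k).1, antitone_nat_of_succ_le fun k => hsub _ _, fun k => (S k).2, ?_⟩
  intro i j hij q₁ q₂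
  obtain ⟨k, hk⟩ := he (i, j, q₁, q₂)
  have h1 := hcut (S k) (e k)
  rw [hk] at h1
  refine ⟨k + 1, ?_⟩
  have h2 : S (k + 1) = next (S k) (i, j, q₁, q₂) := by rw [← hk]
  simp only [h2]
  exact h1 hij

/-- A set is contained in a line as soon as its projections to pairs of coordinates are contained
in half-planes through all rational points. -/
theorem exists_line_of_forall_exists_halfplane {n : ℕ} {K : Set (Fin (n + 1) → ℝ)}
    (hK : K.Nonempty)
    (h : ∀ i j, i ≠ j → ∀ q₁ q₂ : ℚ, ∃ α β : ℝ, (α ≠ 0 ∨ β ≠ 0) ∧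
        ∀ x ∈ K, 0 ≤ α * (x i - q₁) + β * (x j - q₂)) :
    ∃ (i : Fin (n + 1)) (a v : Fin (n + 1) → ℝ), ∀ x ∈ K, ∀ j, x j = a j + v j * x i := by
  obtain ⟨x, hx⟩ := hK
  by_cases hsub : ∀ y ∈ K, y = x
  · exact ⟨0, x, 0, fun y hy j => by simp [hsub y hy]⟩
  push Not at hsub
  obtain ⟨y, hy, hyx⟩ := hsub
  obtain ⟨i, hi⟩ := Function.ne_iff.1 hyx
  have hi' : y i - x i ≠ 0 := sub_ne_zero.2 hi
  have key : ∀ z ∈ K, ∀ j, (y i - x i) * (z j - x j) - (y j - x j) * (z i - x i) = 0 := by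
    intro z hz j
    by_contra hdet
    have hij : i ≠ j := by rintro rfl; exact hdet (by ring)
    set Δ := (y i - x i) * (z j - x j) - (y j - x j) * (z i - x i) with hΔ
    set s : ℝ × ℝ → ℝ := fun c => ((z j - x j) * (c.1 - x i) - (z i - x i) * (c.2 - x j)) / Δ with hs
    set t : ℝ × ℝ → ℝ := fun c => (-(y j - x j) * (c.1 - x i) + (y i - x i) * (c.2 - x j)) / Δ with ht
    have hsc : Continuous s := by simp only [hs]; fun_prop
    have htc : Continuous t := by simp only [ht]; fun_prop
    have hopen : IsOpen {c : ℝ × ℝ | 0 < s c ∧ 0 < t c ∧ s c + t c < 1} :=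
      (isOpen_lt continuous_const hsc).inter ((isOpen_lt continuous_const htc).inter
        (isOpen_lt (hsc.add htc) continuous_const))
    have hne : {c : ℝ × ℝ | 0 < s c ∧ 0 < t c ∧ s c + t c < 1}.Nonempty := by
      refine ⟨((x i + y i + z i) / 3, (x j + y j + z j) / 3), ?_⟩
      have h1 : s ((x i + y i + z i) / 3, (x j + y j + z j) / 3) = 1 / 3 := by
        simp only [hs]; rw [div_eq_iff hdet, hΔ]; ring
      have h2 : t ((x i + y i + z i) / 3, (x j + y j + z j) / 3) = 1 / 3 := by
        simp only [ht]; rw [div_eq_iff hdet, hΔ]; ring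
      simp only [Set.mem_ofPred_eq, h1, h2]
      norm_num
    obtain ⟨⟨q₁, q₂⟩, hq0, hq1, hq2⟩ :=
      ((Rat.denseRange_cast (𝕜 := ℝ)).prodMap (Rat.denseRange_cast (𝕜 := ℝ))).exists_mem_open
        hopen hne
    simp only [Prod.map_apply] at hq0 hq1 hq2
    obtain ⟨α, β, hαβ, hpos⟩ := h i j hij q₁ q₂
    set σ := s (q₁, q₂) with hσ
    set τ := t (q₁, q₂) with hτ
    have e1 : (1 - σ - τ) * x i + σ * y i + τ * z i = q₁ := by
      simp only [hσ, hτ, hs, ht]; field_simp; rw [hΔ]; ring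
    have e2 : (1 - σ - τ) * x j + σ * y j + τ * z j = q₂ := by
      simp only [hσ, hτ, hs, ht]; field_simp; rw [hΔ]; ring
    have hX := hpos x hx
    have hY := hpos y hy
    have hZ := hpos z hz
    set X := α * (x i - q₁) + β * (x j - q₂) with hXd
    set Y := α * (y i - q₁) + β * (y j - q₂) with hYd
    set Z := α * (z i - q₁) + β * (z j - q₂) with hZd
    have hsum : (1 - σ - τ) * X + σ * Y + τ * Z = 0 := by
      rw [hXd, hYd, hZd]; linear_combination α * e1 + β * e2
    have p1 : 0 ≤ (1 - σ - τ) * X := mul_nonneg (by linarith) hX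
    have p2 : 0 ≤ σ * Y := mul_nonneg hq0.le hY
    have p3 : 0 ≤ τ * Z := mul_nonneg hq1.le hZ
    have hX0 : X = 0 := by
      rcases mul_eq_zero.1 (show (1 - σ - τ) * X = 0 by linarith) with h | h
      · linarith
      · exact h
    have hY0 : Y = 0 := by
      rcases mul_eq_zero.1 (show σ * Y = 0 by linarith) with h | h
      · linarith
      · exact h
    have hZ0 : Z = 0 := by
      rcases mul_eq_zero.1 (show τ * Z = 0 by linarith) with h | h
      · linarith
      · exact h
    have f1 : α * (y i - x i) + β * (y j - x j) = 0 := by linarith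
    have f2 : α * (z i - x i) + β * (z j - x j) = 0 := by linarith
    have g1 : α * Δ = 0 := by rw [hΔ]; linear_combination (z j - x j) * f1 - (y j - x j) * f2
    have g2 : β * Δ = 0 := by rw [hΔ]; linear_combination (y i - x i) * f2 - (z i - x i) * f1
    rcases hαβ with h | h
    · exact (mul_ne_zero h hdet) g1
    · exact (mul_ne_zero h hdet) g2
  refine ⟨i, fun j => x j - (y j - x j) / (y i - x i) * x i,
    fun j => (y j - x j) / (y i - x i), fun z hz j => ?_⟩
  have := key z hz j
  field_simp
  linarith

theorem Polynomial.setIntegral_mul_volume_le {n : ℕ} (i : Fin (n + 1))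
    {S : Set (Fin (n + 1) → ℝ)} (hS : IsCompact S) (hSc : Convex ℝ S) {p : Polynomial ℝ} {d : ℕ}
    (hd : d ≠ 0) (hp : p.natDegree ≤ d) {a : ℝ} (ha : 0 ≤ a) :
    (∫ x in S, |p.eval (x i)| ^ (d : ℝ)⁻¹) *
        volume.real (S ∩ {x | |p.eval (x i)| ≤ a ^ d}) ≤
      4 * Real.exp 1 * a * volume.real S ^ 2 := by
  have h := Polynomial.setLIntegral_mul_volume_le i hS hSc hd hp ha
  have hcont : Continuous fun x : Fin (n + 1) → ℝ => |p.eval (x i)| ^ (d : ℝ)⁻¹ := by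
    refine Continuous.rpow_const ?_ fun _ => Or.inr (by positivity)
    fun_prop
  have hint : IntegrableOn (fun x : Fin (n + 1) → ℝ => |p.eval (x i)| ^ (d : ℝ)⁻¹) S :=
    hcont.continuousOn.integrableOn_compact hS
  rw [← ofReal_integral_eq_lintegral_ofReal hint
    (Filter.Eventually.of_forall fun x => by positivity)] at h
  have h' := ENNReal.toReal_mono
    (ENNReal.mul_ne_top ENNReal.ofReal_ne_top (ENNReal.pow_ne_top hS.measure_lt_top.ne)) h
  rw [ENNReal.toReal_mul, ENNReal.toReal_mul, ENNReal.toReal_pow,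
    ENNReal.toReal_ofReal (integral_nonneg fun x => by positivity),
    ENNReal.toReal_ofReal (show 0 ≤ 4 * Real.exp 1 * a by positivity)] at h'
  exact h'

/-- Distributional inequality for polynomials on convex bodies. -/
theorem MvPolynomial.setIntegral_mul_volume_le {n : ℕ} (P : MvPolynomial (Fin (n + 1)) ℝ) {d : ℕ}
    (hd : d ≠ 0) (hP : P.totalDegree ≤ d) {F : Set (Fin (n + 1) → ℝ)} (hF : IsCompact F)
    (hFc : Convex ℝ F) {a : ℝ} (ha : 0 ≤ a) :
    (∫ x in F, |MvPolynomial.eval x P| ^ (d : ℝ)⁻¹) *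
        volume.real (F ∩ {x | |MvPolynomial.eval x P| ≤ a ^ d}) ≤
      4 * Real.exp 1 * a * volume.real F ^ 2 := by
  set g : (Fin (n + 1) → ℝ) → ℝ := fun x => |MvPolynomial.eval x P| ^ (d : ℝ)⁻¹ with hg
  have hg0 : ∀ x, 0 ≤ g x := fun x => by simp only [hg]; positivity
  have hgc : Continuous g := by
    refine Continuous.rpow_const ?_ fun _ => Or.inr (by positivity)
    exact (MvPolynomial.continuous_eval P).abs
  have hle : ∀ y b : ℝ, 0 ≤ b → (|y| ≤ b ^ d ↔ |y| ^ (d : ℝ)⁻¹ ≤ b) := fun y b hb => by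
    rw [Real.rpow_inv_le_iff_of_pos (abs_nonneg _) hb (by positivity), Real.rpow_natCast]
  set D := {x | |MvPolynomial.eval x P| ≤ a ^ d} with hD
  rcases (measureReal_nonneg (μ := volume) (s := F)).eq_or_lt with hV | hV
  · have : volume.real (F ∩ D) ≤ 0 :=
      hV ▸ measureReal_mono Set.inter_subset_left hF.measure_lt_top.ne
    rw [← hV, le_antisymm this measureReal_nonneg]
    simp
  by_contra! hcon
  set c := (∫ x in F, g x) / volume.real F with hc
  have hc0 : 0 ≤ c := div_nonneg (integral_nonneg hg0) hV.le
  have hcV : ∫ x in F, g x = c * volume.real F := by rw [hc]; field_simp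
  rw [hcV] at hcon
  have hcpos : 0 < c := by
    rcases hc0.eq_or_lt with h | h
    · rw [← h] at hcon
      have : 0 ≤ 4 * Real.exp 1 * a * volume.real F ^ 2 := by positivity
      linarith
    · exact h
  have hcon' : 4 * Real.exp 1 * a / c < volume.real (F ∩ D) / volume.real F := by
    rw [div_lt_div_iff₀ hcpos hV]
    nlinarith
  obtain ⟨η, hη1, hη2⟩ := exists_between hcon'
  have hη0 : 0 < η := lt_of_le_of_lt (by positivity) hη1
  rw [lt_div_iff₀ hV] at hη2
  rw [div_lt_iff₀ hcpos] at hη1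
  have hbal : IsBalancedBody (fun x => g x - c) D η F := by
    refine ⟨hF, hFc, ?_, hη2⟩
    rw [integral_sub (hgc.continuousOn.integrableOn_compact hF)
      (integrableOn_const hF.measure_lt_top.ne), hcV, setIntegral_const, smul_eq_mul]
    ring
  have huc : Continuous fun x => g x - c := hgc.sub continuous_const
  obtain ⟨S, hSa, hSb, hScut⟩ := hbal.exists_antitone_seq huc
  have hSpos : ∀ k, 0 < volume.real (S k) := fun k => by
    have h1 := (hSb k).lt_volume_inter
    have h2 : volume.real (S k ∩ D) ≤ volume.real (S k) :=
      measureReal_mono Set.inter_subset_left (hSb k).isCompact.measure_lt_top.ne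
    have h3 : 0 ≤ η * volume.real (S k) := by positivity
    linarith
  have hSne : ∀ k, (S k).Nonempty := fun k => by
    rw [Set.nonempty_iff_ne_empty]
    intro h0
    have := hSpos k
    simp [h0] at this
  have hKne : (⋂ k, S k).Nonempty :=
    IsCompact.nonempty_iInter_of_sequence_nonempty_isCompact_isClosed S
      (fun k => hSa (Nat.le_succ k)) hSne (hSb 0).isCompact fun k => (hSb k).isCompact.isClosed
  obtain ⟨i, b, v, hline⟩ := exists_line_of_forall_exists_halfplane hKne fun i j hij q₁ q₂ => by
    obtain ⟨k, α, β, hαβ, h⟩ := hScut i j hij q₁ q₂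
    exact ⟨α, β, hαβ, fun x hx => h x (Set.mem_iInter.1 hx k)⟩
  set Q : Polynomial ℝ :=
    MvPolynomial.aeval (fun j => Polynomial.C (b j) + Polynomial.C (v j) * Polynomial.X) P with hQ
  have hQd : Q.natDegree ≤ d := by
    have := MvPolynomial.aeval_natDegree_le P hP
      (fun j => Polynomial.C (b j) + Polynomial.C (v j) * Polynomial.X) (n := 1) fun j => by
        rw [add_comm]; exact Polynomial.natDegree_linear_le
    simpa using this
  have hQe : ∀ t, Q.eval t = MvPolynomial.eval (fun j => b j + v j * t) P := by
    intro t
    have h1 : (Polynomial.evalRingHom t).comp (algebraMap ℝ (Polynomial ℝ)) = RingHom.id ℝ := by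
      ext r
      simp
    rw [hQ, MvPolynomial.aeval_def, MvPolynomial.polynomial_eval_eval₂, h1]
    simp only [Polynomial.eval_add, Polynomial.eval_mul, Polynomial.eval_C, Polynomial.eval_X]
    rfl
  set G : (Fin (n + 1) → ℝ) → ℝ := fun x => |Q.eval (x i)| ^ (d : ℝ)⁻¹ with hG
  have hGc : Continuous G := by
    refine Continuous.rpow_const ?_ fun _ => Or.inr (by positivity)
    fun_prop
  have hmain : ∀ ω > 0, (c - ω) * η ≤ 4 * Real.exp 1 * (a + ω) := by
    intro ω hω
    have hopen : IsOpen {x | |g x - G x| < ω} := isOpen_lt (hgc.sub hGc).abs continuous_const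
    obtain ⟨k, hk⟩ : ∃ k, S k ⊆ {x | |g x - G x| < ω} := by
      refine exists_subset_nhds_of_isCompact' (directed_of_isDirected_le hSa)
        (fun k => (hSb k).isCompact) (fun k => (hSb k).isCompact.isClosed) fun x hx => ?_
      refine hopen.mem_nhds ?_
      have hxe : (fun j => b j + v j * x i) = x := by
        ext j
        exact (hline x hx j).symm
      have : g x = G x := by simp only [hg, hG, hQe, hxe]
      simpa [this] using hω
    have h1 := Polynomial.setIntegral_mul_volume_le i (hSb k).isCompact (hSb k).convex hd hQd
      (a := a + ω) (by positivity)
    have hfin : volume (S k) ≠ ⊤ := (hSb k).isCompact.measure_lt_top.ne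
    have hgi := hgc.continuousOn.integrableOn_compact (μ := volume) (hSb k).isCompact
    have hGi := hGc.continuousOn.integrableOn_compact (μ := volume) (hSb k).isCompact
    have hmean := (hSb k).integral_eq_zero
    rw [integral_sub hgi (integrableOn_const hfin), setIntegral_const, smul_eq_mul] at hmean
    have h2 : (c - ω) * volume.real (S k) ≤ ∫ x in S k, G x := by
      have : ∫ x in S k, (g x - ω) ≤ ∫ x in S k, G x := by
        refine setIntegral_mono_on (Integrable.sub hgi (integrableOn_const (C := ω) hfin)) hGi
          (hSb k).isCompact.isClosed.measurableSet fun x hx => ?_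
        have := abs_lt.1 (show |g x - G x| < ω from hk hx)
        linarith
      rw [integral_sub hgi (integrableOn_const hfin), setIntegral_const, smul_eq_mul] at this
      linarith
    have h3 : η * volume.real (S k) ≤ volume.real (S k ∩ {x | |Q.eval (x i)| ≤ (a + ω) ^ d}) := by
      refine (hSb k).lt_volume_inter.le.trans (measureReal_mono ?_
        (measure_ne_top_of_subset Set.inter_subset_left hfin))
      rintro x ⟨hx, hxD⟩
      refine ⟨hx, ?_⟩
      rw [Set.mem_ofPred_eq, hle _ _ (by positivity)]
      have h4 := (hle _ _ ha).1 hxD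
      have h5 := abs_lt.1 (show |g x - G x| < ω from hk hx)
      simp only [hg, hG] at h5
      linarith
    rcases le_total c ω with hcω | hcω
    · refine (mul_nonpos_of_nonpos_of_nonneg (by linarith) hη0.le).trans (by positivity)
    have h6 := (mul_le_mul h2 h3 (by positivity) (integral_nonneg fun x => by
      simp only [hG]; positivity)).trans h1
    have hV2 : 0 < volume.real (S k) ^ 2 := pow_pos (hSpos k) 2
    refine le_of_mul_le_mul_right ?_ hV2
    linarith
  have hlim : c * η ≤ 4 * Real.exp 1 * a := by
    have t1 : Filter.Tendsto (fun ω : ℝ => (c - ω) * η) (nhdsWithin 0 (Set.Ioi 0))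
        (nhds ((c - 0) * η)) :=
      ((by fun_prop : Continuous fun ω : ℝ => (c - ω) * η).tendsto 0).mono_left nhdsWithin_le_nhds
    have t2 : Filter.Tendsto (fun ω : ℝ => 4 * Real.exp 1 * (a + ω)) (nhdsWithin 0 (Set.Ioi 0))
        (nhds (4 * Real.exp 1 * (a + 0))) :=
      ((by fun_prop : Continuous fun ω : ℝ => 4 * Real.exp 1 * (a + ω)).tendsto 0).mono_left
        nhdsWithin_le_nhds
    have := le_of_tendsto_of_tendsto t1 t2 (by
      filter_upwards [self_mem_nhdsWithin] with ω hω using hmain ω hω)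
    simpa using this
  linarith

/-- A distributional inequality for `g` on `F` controls the averages of `log g` on subsets of `F`. -/
theorem setIntegral_log_bounds {X : Type*} [MeasurableSpace X] {μ : Measure X} {F E : Set X}
    {g : X → ℝ} (hgm : Measurable g) (hg0 : ∀ x, 0 ≤ g x) (hgi : IntegrableOn g F μ)
    (hF : μ F ≠ ⊤) (hI : 0 < ∫ x in F, g x ∂μ) {C : ℝ} (hC : 0 < C)
    (hdist : ∀ a, 0 ≤ a →
      (∫ x in F, g x ∂μ) * μ.real (F ∩ {x | g x ≤ a}) ≤ C * a * μ.real F ^ 2)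
    (hEF : E ⊆ F) (hE : μ E ≠ 0) :
    μ.real E * (Real.log ((∫ x in F, g x ∂μ) * μ.real E / (C * μ.real F ^ 2)) - 1) ≤
        ∫ x in E, Real.log (g x) ∂μ ∧
      ∫ x in E, Real.log (g x) ∂μ ≤ μ.real E * Real.log ((∫ x in F, g x ∂μ) / μ.real E) := by
  set I := ∫ x in F, g x ∂μ with hIdef
  have hEfin : μ E ≠ ⊤ := measure_ne_top_of_subset hEF hF
  have hEpos : 0 < μ.real E := ENNReal.toReal_pos hE hEfin
  have hFpos : 0 < μ.real F := hEpos.trans_le (measureReal_mono hEF hF)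
  set K := I * μ.real E / (C * μ.real F ^ 2) with hK
  have hKpos : 0 < K := by positivity
  have hKeq : ∀ a, C * a * μ.real F ^ 2 / I = μ.real E * (a / K) := fun a => by
    rw [hK]; field_simp
  have hsub : ∀ a, 0 ≤ a → μ (E ∩ {x | g x ≤ a}) ≤ ENNReal.ofReal (μ.real E * (a / K)) := by
    intro a ha
    have h1 : μ (F ∩ {x | g x ≤ a}) ≠ ⊤ := measure_ne_top_of_subset Set.inter_subset_left hF
    refine (measure_mono (Set.inter_subset_inter_left _ hEF)).trans ?_
    rw [← ofReal_measureReal h1]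
    refine ENNReal.ofReal_le_ofReal ?_
    rw [← hKeq, le_div_iff₀ hI, mul_comm]
    exact hdist a ha
  set h : X → ℝ := fun x => max (Real.log K - Real.log (g x)) 0 with hh
  have hhm : Measurable h := by fun_prop
  have hh0 : ∀ x, 0 ≤ h x := fun x => le_max_right _ _
  have hlint : ∫⁻ x in E, ENNReal.ofReal (h x) ∂μ ≤ ENNReal.ofReal (μ.real E) := by
    rw [lintegral_eq_lintegral_meas_le _ (Filter.Eventually.of_forall hh0) hhm.aemeasurable]
    calc ∫⁻ t in Set.Ioi (0 : ℝ), μ.restrict E {x | t ≤ h x}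
        ≤ ∫⁻ t in Set.Ioi (0 : ℝ), ENNReal.ofReal (μ.real E * Real.exp (-t)) := by
          refine setLIntegral_mono (by fun_prop) fun t ht => ?_
          rw [Measure.restrict_apply (measurableSet_le measurable_const hhm), Set.inter_comm]
          refine (measure_mono ?_).trans ((hsub (K * Real.exp (-t)) (by positivity)).trans
            (ENNReal.ofReal_le_ofReal ?_))
          · rintro x ⟨hxE, hx⟩
            refine ⟨hxE, ?_⟩
            have hx' : t ≤ max (Real.log K - Real.log (g x)) 0 := hx
            show g x ≤ K * Real.exp (-t)
            rcases le_max_iff.1 hx' with hx' | hx'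
            · rcases (hg0 x).eq_or_lt with h0 | h0
              · rw [← h0]; positivity
              · rw [← Real.exp_log hKpos, ← Real.exp_add, ← Real.log_le_iff_le_exp h0]
                linarith
            · exact absurd hx' (not_le.2 ht)
          · rw [mul_div_cancel_left₀ _ hKpos.ne']
      _ = ENNReal.ofReal (μ.real E) := by
          rw [← ofReal_integral_eq_lintegral_ofReal
            ((integrableOn_exp_neg_Ioi 0).const_mul _)
            (Filter.Eventually.of_forall fun t => by positivity),
            integral_const_mul, integral_exp_neg_Ioi_zero, mul_one]
  have hhi : IntegrableOn h E μ := by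
    refine ⟨hhm.aestronglyMeasurable, ?_⟩
    rw [hasFiniteIntegral_iff_ofReal (Filter.Eventually.of_forall hh0)]
    exact hlint.trans_lt ENNReal.ofReal_lt_top
  have hhint : ∫ x in E, h x ∂μ ≤ μ.real E := by
    rw [integral_eq_lintegral_of_nonneg_ae (Filter.Eventually.of_forall hh0)
      hhm.aestronglyMeasurable]
    exact ENNReal.toReal_le_of_le_ofReal hEpos.le hlint
  have hgE : IntegrableOn g E μ := hgi.mono_set hEF
  have hconst : ∀ r : ℝ, IntegrableOn (fun _ => r) E μ := fun r => integrableOn_const hEfin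
  have hlow : ∀ x, Real.log K - h x ≤ Real.log (g x) := fun x => by
    have := le_max_left (Real.log K - Real.log (g x)) 0
    simp only [hh]
    linarith
  have hlogi : IntegrableOn (fun x => Real.log (g x)) E μ := by
    refine Integrable.mono' ((hgE.add (hconst |Real.log K|)).add hhi)
      hgm.log.aestronglyMeasurable (Filter.Eventually.of_forall fun x => ?_)
    rw [Real.norm_eq_abs, abs_le]
    simp only [Pi.add_apply]
    have h1 := hlow x
    have h2 := Real.log_le_self (hg0 x)
    have h3 := neg_abs_le (Real.log K)
    have h4 := abs_nonneg (Real.log K)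
    have h5 := hh0 x
    have h6 := hg0 x
    constructor <;> linarith
  constructor
  · have h1 := setIntegral_mono ((hconst (Real.log K)).sub hhi) hlogi hlow
    have h2 : ∫ x in E, (Real.log K - h x) ∂μ = μ.real E * Real.log K - ∫ x in E, h x ∂μ := by
      rw [integral_sub (hconst _) hhi, setIntegral_const, smul_eq_mul]
    have h3 : ∫ x in E, (Real.log K - h x) ∂μ ≤ ∫ x in E, Real.log (g x) ∂μ := h1
    linarith
  · set L := I / μ.real E with hL
    have hLpos : 0 < L := by positivity
    have hpos : ∀ᵐ x ∂μ.restrict E, 0 < g x := by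
      rw [ae_iff, Measure.restrict_apply (by simpa using measurableSet_le hgm measurable_const)]
      have := hsub 0 le_rfl
      rw [Set.inter_comm]
      simpa using this
    have h1 : ∫ x in E, Real.log (g x) ∂μ ≤ ∫ x in E, (g x / L + (Real.log L - 1)) ∂μ := by
      refine integral_mono_ae hlogi ((hgE.div_const L).add (hconst _)) ?_
      filter_upwards [hpos] with x hx
      have := Real.log_le_sub_one_of_pos (div_pos hx hLpos)
      rw [Real.log_div hx.ne' hLpos.ne'] at this
      linarith
    rw [integral_add (hgE.div_const L) (hconst _), integral_div, setIntegral_const,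
      smul_eq_mul] at h1
    have h2 : ∫ x in E, g x ∂μ ≤ I :=
      setIntegral_mono_set hgi (Filter.Eventually.of_forall hg0) hEF.eventuallyLE
    have h3 : (∫ x in E, g x ∂μ) / L ≤ μ.real E := by
      rw [div_le_iff₀ hLpos, hL, mul_div_cancel₀ _ hEpos.ne']
      exact h2
    linarith

theorem MvPolynomial.setIntegral_rpow_pos {n : ℕ} {P : MvPolynomial (Fin n) ℝ} (hP : P ≠ 0)
    {F : Set (Fin n → ℝ)} (hF : IsCompact F) (hFc : Convex ℝ F) (hFv : volume F ≠ 0)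
    {r : ℝ} (hr : 0 < r) : 0 < ∫ x in F, |MvPolynomial.eval x P| ^ r := by
  have hcont : Continuous fun x : Fin n → ℝ => |MvPolynomial.eval x P| ^ r :=
    (MvPolynomial.continuous_eval P).abs.rpow_const fun _ => Or.inr hr.le
  rw [setIntegral_pos_iff_support_of_nonneg_ae
    (Filter.Eventually.of_forall fun x => by positivity)
    (hcont.continuousOn.integrableOn_compact hF)]
  have hint : (interior F).Nonempty := by
    rw [Set.nonempty_iff_ne_empty]
    intro h0
    refine hFv (measure_mono_null ?_ (hFc.addHaar_frontier volume))
    rw [hF.isClosed.frontier_eq, h0, Set.sdiff_empty]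
  obtain ⟨y, hy, hyP⟩ : ∃ y ∈ interior F, MvPolynomial.eval y P ≠ 0 := by
    by_contra! hzero
    obtain ⟨y, hy⟩ := hint
    obtain ⟨ε, hε, hball⟩ := Metric.isOpen_iff.1 isOpen_interior y hy
    refine hP (MvPolynomial.funext_set (fun i => Metric.ball (y i) ε) (fun i => ?_) fun x hx => ?_)
    · rw [Real.ball_eq_Ioo]
      exact Set.Ioo_infinite (by linarith)
    · rw [map_zero]
      refine hzero x (hball ?_)
      rw [ball_pi _ hε]
      exact hx
  have hopen : IsOpen (interior F ∩ {x | MvPolynomial.eval x P ≠ 0}) :=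
    isOpen_interior.inter
      (isOpen_ne_fun (MvPolynomial.continuous_eval P) continuous_const)
  refine (hopen.measure_pos volume ⟨y, hy, hyP⟩).trans_le (measure_mono ?_)
  rintro x ⟨hxF, hxP⟩
  refine ⟨?_, interior_subset hxF⟩
  rw [Function.mem_support]
  exact (Real.rpow_pos_of_pos (abs_pos.2 hxP) _).ne'

theorem MvPolynomial.average_log_comparison {n : ℕ} {d : ℕ} {P : MvPolynomial (Fin n) ℝ}
    (hPd : P.totalDegree ≤ d) (hPnc : ∀ c : ℝ, P ≠ MvPolynomial.C c)
    {F : Set (Fin n → ℝ)} (hF : IsCompact F) (hFc : Convex ℝ F)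
    {E : Set (Fin n → ℝ)} (hEF : E ⊆ F) (hE : volume E ≠ 0) :
    |(1 / volume.real E) * (∫ x in E, Real.log |MvPolynomial.eval x P|) -
      (1 / volume.real F) * (∫ x in F, Real.log |MvPolynomial.eval x P|)| ≤
      d * Real.log (4 * Real.exp 2 * volume.real F / volume.real E) := by
  have hd : d ≠ 0 := by
    rintro rfl
    exact hPnc _ (MvPolynomial.totalDegree_eq_zero_iff_eq_C.1 (Nat.le_zero.1 hPd))
  obtain _ | m := n
  · exact absurd (MvPolynomial.eq_C_of_isEmpty P) (hPnc _)
  have hd' : (0 : ℝ) < d := by positivity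
  have hFv : volume F ≠ 0 := fun h => hE (measure_mono_null hEF h)
  have hFfin : volume F ≠ ⊤ := hF.measure_lt_top.ne
  set g : (Fin (m + 1) → ℝ) → ℝ := fun x => |MvPolynomial.eval x P| ^ (d : ℝ)⁻¹ with hg
  have hg0 : ∀ x, 0 ≤ g x := fun x => by simp only [hg]; positivity
  have hgc : Continuous g :=
    (MvPolynomial.continuous_eval P).abs.rpow_const fun _ => Or.inr (by positivity)
  have hI : 0 < ∫ x in F, g x := MvPolynomial.setIntegral_rpow_pos
    (fun h => hPnc 0 (by rw [h, map_zero])) hF hFc hFv (by positivity)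
  have hdist : ∀ a, 0 ≤ a → (∫ x in F, g x) * volume.real (F ∩ {x | g x ≤ a}) ≤
      4 * Real.exp 1 * a * volume.real F ^ 2 := by
    intro a ha
    have hset : {x | g x ≤ a} = {x | |MvPolynomial.eval x P| ≤ a ^ d} := by
      ext x
      show |MvPolynomial.eval x P| ^ (d : ℝ)⁻¹ ≤ a ↔ |MvPolynomial.eval x P| ≤ a ^ d
      rw [Real.rpow_inv_le_iff_of_pos (abs_nonneg _) ha hd', Real.rpow_natCast]
    rw [hset]
    exact P.setIntegral_mul_volume_le hd hPd hF hFc ha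
  have hlog : ∀ x, Real.log |MvPolynomial.eval x P| = d * Real.log (g x) := fun x => by
    rcases (abs_nonneg (MvPolynomial.eval x P)).eq_or_lt with h | h
    · simp [hg, ← h, hd]
    · simp only [hg]
      rw [Real.log_rpow h, mul_inv_cancel_left₀ hd'.ne']
  have hbound := fun S (hS : S ⊆ F) (hS0 : volume S ≠ 0) => setIntegral_log_bounds hgc.measurable
    hg0 (hgc.continuousOn.integrableOn_compact hF) hFfin hI
    (show 0 < 4 * Real.exp 1 by positivity) hdist hS hS0
  obtain ⟨hE1, hE2⟩ := hbound E hEF hE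
  obtain ⟨hF1, hF2⟩ := hbound F subset_rfl hFv
  have hEpos : 0 < volume.real E :=
    ENNReal.toReal_pos hE (measure_ne_top_of_subset hEF hFfin)
  have hFpos : 0 < volume.real F := ENNReal.toReal_pos hFv hFfin
  simp only [hlog, integral_const_mul]
  set I := ∫ x in F, g x with hIdef
  rw [← le_div_iff₀' hEpos] at hE1
  rw [← div_le_iff₀' hEpos] at hE2
  rw [← le_div_iff₀' hFpos] at hF1
  rw [← div_le_iff₀' hFpos] at hF2
  have he : Real.log (4 * Real.exp 2 * volume.real F / volume.real E) =
      Real.log 4 + 2 + Real.log (volume.real F) - Real.log (volume.real E) := by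
    rw [Real.log_div (by positivity) hEpos.ne', Real.log_mul (by positivity) hFpos.ne',
      Real.log_mul (by norm_num) (by positivity), Real.log_exp]
  have hlow : ∀ s : ℝ, 0 < s → Real.log (I * s / (4 * Real.exp 1 * volume.real F ^ 2)) =
      Real.log I + Real.log s - (Real.log 4 + 1 + 2 * Real.log (volume.real F)) := fun s hs => by
    rw [Real.log_div (by positivity) (by positivity), Real.log_mul hI.ne' hs.ne',
      Real.log_mul (by positivity) (by positivity), Real.log_mul (by norm_num) (by positivity),
      Real.log_exp, Real.log_pow]
    norm_num
  rw [hlow _ hEpos] at hE1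
  rw [hlow _ hFpos] at hF1
  rw [Real.log_div hI.ne' hEpos.ne'] at hE2
  rw [Real.log_div hI.ne' hFpos.ne'] at hF2
  rw [he, abs_le]
  have hfac : ∀ A B : ℝ, 1 / volume.real E * (d * A) - 1 / volume.real F * (d * B) =
      d * (A / volume.real E - B / volume.real F) := fun A B => by ring
  rw [hfac, ← mul_neg]
  constructor <;> refine mul_le_mul_of_nonneg_left ?_ hd'.le <;> linarith

/-- Comparison of averages of `log|P|` over a measurable subset `E` and over the
whole compact convex set `F`:
`|⟨log|P|⟩_E - ⟨log|P|⟩_F| ≤ d·log(4e²·Vol(F)/Vol(E))`. -/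
theorem average_log_comparison {n : ℕ} (d : ℕ) (P : MvPolynomial (Fin n) ℝ)
    (hPd : P.totalDegree ≤ d) (hPnc : ∀ c : ℝ, P ≠ MvPolynomial.C c)
    (F : Set (EuclideanSpace ℝ (Fin n))) (hFcomp : IsCompact F) (hFconv : Convex ℝ F)
    (hFvol : 0 < volume F)
    (E : Set (EuclideanSpace ℝ (Fin n))) (hE : MeasurableSet E) (hEF : E ⊆ F)
    (hEvol : 0 < volume E) :
    |(1 / (volume E).toReal) *
        (∫ x in E, Real.log |MvPolynomial.eval (fun i => x i) P|) -
      (1 / (volume F).toReal) *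
        (∫ x in F, Real.log |MvPolynomial.eval (fun i => x i) P|)| ≤
      d * Real.log (4 * Real.exp 2 * (volume F).toReal / (volume E).toReal) := by
  set e : (Fin n → ℝ) ≃L[ℝ] EuclideanSpace ℝ (Fin n) :=
    (PiLp.continuousLinearEquiv 2 ℝ fun _ => ℝ).symm with he
  have hmp : MeasurePreserving e := PiLp.volume_preserving_toLp (Fin n)
  have hemb : MeasurableEmbedding e := e.toHomeomorph.measurableEmbedding
  have hvol : ∀ S, volume (e ⁻¹' S) = volume S := fun S => hmp.measure_preimage_emb hemb S
  have hint : ∀ S, ∫ x in e ⁻¹' S, Real.log |MvPolynomial.eval x P| =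
      ∫ x in S, Real.log |MvPolynomial.eval (fun i => x i) P| := fun S =>
    hmp.setIntegral_preimage_emb hemb
      (fun x => Real.log |MvPolynomial.eval (fun i => x i) P|) S
  have h := MvPolynomial.average_log_comparison hPd hPnc (F := e ⁻¹' F) (E := e ⁻¹' E)
    (e.toHomeomorph.isCompact_preimage.2 hFcomp)
    (hFconv.linear_preimage e.toLinearMap) (Set.preimage_mono hEF)
    ((hvol E).trans_ne hEvol.ne')
  rw [hint, hint, measureReal_def, measureReal_def, hvol, hvol] at h
  exact h
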